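/- arXiv:2402.08612 — 2 statements merged into one kernel-verified Lean document; each statement's English description precedes it below -/
import Mathlib

section
/- Let S ⊆ Γ = SL₂(ℤ)×SL₂(ℤ)×SL₂(ℤ) be a finite symmetric set generating a group that is Zariski-dense in SL₂×SL₂×SL₂. Then there exist c > 0 and l₀ ∈ ℤ₊, depending only on S, such that for every primitive linear form L and every integer l ≥ l₀, one has χ_S^{(l)}({g ∈ Γ : L(g) = 0}) < e^{−c l}. -/
open Matrix Pointwise

abbrev SL2Z := Matrix.SpecialLinearGroup (Fin 2) ℤ
abbrev SL2C := Matrix.SpecialLinearGroup (Fin 2) ℂ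
abbrev GammaSL : Type := SL2Z × SL2Z × SL2Z
abbrev GammaC : Type := SL2C × SL2C × SL2C

def entryZ (g : GammaSL) : Fin 3 × Fin 2 × Fin 2 → ℤ :=
  fun x => ![(g.1 : Matrix (Fin 2) (Fin 2) ℤ), (g.2.1 : Matrix (Fin 2) (Fin 2) ℤ),
    (g.2.2 : Matrix (Fin 2) (Fin 2) ℤ)] x.1 x.2.1 x.2.2

noncomputable def entryC (g : GammaC) : Fin 3 × Fin 2 × Fin 2 → ℂ :=
  fun x => ![(g.1 : Matrix (Fin 2) (Fin 2) ℂ), (g.2.1 : Matrix (Fin 2) (Fin 2) ℂ),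
    (g.2.2 : Matrix (Fin 2) (Fin 2) ℂ)] x.1 x.2.1 x.2.2

/-- Zariski density of a subgroup of `SL₂(ℤ)³` in `SL₂ × SL₂ × SL₂`. -/
def ZariskiDense (G : Subgroup GammaSL) : Prop :=
  ∀ P : MvPolynomial (Fin 3 × Fin 2 × Fin 2) ℚ,
    (∀ g ∈ G, (MvPolynomial.aeval (fun x => (entryZ g x : ℂ))) P = 0) →
    ∀ h : GammaC, (MvPolynomial.aeval (entryC h)) P = 0

/-- Entrywise reduction mod `q` on `SL₂(ℤ)`. -/
def redSL (q : ℕ) : SL2Z →* Matrix.SpecialLinearGroup (Fin 2) (ZMod q) :=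
  Matrix.SpecialLinearGroup.map (Int.castRingHom (ZMod q))

abbrev GammaMod (q : ℕ) : Type :=
  Matrix.SpecialLinearGroup (Fin 2) (ZMod q) × Matrix.SpecialLinearGroup (Fin 2) (ZMod q) ×
    Matrix.SpecialLinearGroup (Fin 2) (ZMod q)

/-- Entrywise reduction mod `q` on `Γ = SL₂(ℤ)³`. -/
def piq (q : ℕ) : GammaSL →* GammaMod q :=
  (redSL q).prodMap ((redSL q).prodMap (redSL q))

/-- convolution on Γ -/
noncomputable def convG (f g : GammaSL → ℝ) : GammaSL → ℝ := fun x => ∑ᶠ y, f y * g (x * y⁻¹)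

/-- normalized counting measure on S -/
noncomputable def chiS (S : Set GammaSL) : GammaSL → ℝ := S.indicator fun _ => (S.ncard : ℝ)⁻¹

/-- l-fold convolution of χ_S with itself -/
noncomputable def chiIter (S : Set GammaSL) : ℕ → GammaSL → ℝ
  | 0 => fun x => open Classical in if x = 1 then 1 else 0
  | n + 1 => convG (chiS S) (chiIter S n)

/-- The linear form with coefficients `X` evaluated at `g ∈ Γ`. -/
def Lform (X : Fin 3 × Fin 2 × Fin 2 → ℤ) (g : GammaSL) : ℤ :=
  ∑ i : Fin 3 × Fin 2 × Fin 2, X i * entryZ g i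

/-- A primitive linear form: the 12 integer coefficients have gcd 1. -/
def PrimitiveForm (X : Fin 3 × Fin 2 × Fin 2 → ℤ) : Prop :=
  Finset.univ.gcd X = 1

namespace SL2Walk

section Walk

variable {G : Type*} [Group G]

/-- The expectation of `F` at the position, after `l` steps, of the random walk that multiplies on
the left by uniformly chosen elements of `S`. -/
noncomputable def walkE (S : Finset G) : ℕ → (G → ℝ) → ℝ
  | 0, F => F 1
  | l + 1, F => (S.card : ℝ)⁻¹ * ∑ s ∈ S, walkE S l (fun g => F (g * s))

theorem walkE_eq_sum {S : Finset G} (hS : S.Nonempty) (l : ℕ) :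
    ∃ (B : Finset G) (w : G → ℝ), (∀ g, 0 ≤ w g) ∧ ∑ g ∈ B, w g = 1 ∧
      ∀ F : G → ℝ, walkE S l F = ∑ g ∈ B, w g * F g := by
  classical
  induction l with
  | zero => exact ⟨{1}, fun _ => 1, by simp, by simp, by simp [walkE]⟩
  | succ l ih =>
    obtain ⟨B, w, hw, hsum, hF⟩ := ih
    have hc : (0 : ℝ) < S.card := by exact_mod_cast hS.card_pos
    have key : ∀ F : G → ℝ, walkE S (l + 1) F =
        ∑ x ∈ (S ×ˢ B).image (fun p => p.2 * p.1),
          (∑ p ∈ S ×ˢ B with p.2 * p.1 = x, (S.card : ℝ)⁻¹ * w p.2) * F x := by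
      intro F
      have h1 : walkE S (l + 1) F = ∑ p ∈ S ×ˢ B, (S.card : ℝ)⁻¹ * w p.2 * F (p.2 * p.1) := by
        simp only [walkE, hF, Finset.sum_product, Finset.mul_sum, mul_assoc]
      rw [h1, ← Finset.sum_fiberwise_of_maps_to (g := fun p : G × G => p.2 * p.1)
        (t := (S ×ˢ B).image (fun p => p.2 * p.1))
        (fun p hp => Finset.mem_image_of_mem _ hp)]
      refine Finset.sum_congr rfl fun x _ => ?_
      rw [Finset.sum_mul]
      refine Finset.sum_congr rfl fun p hp => ?_
      rw [(Finset.mem_filter.1 hp).2]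
    refine ⟨_, _, fun g => Finset.sum_nonneg fun p _ => mul_nonneg (by positivity) (hw _), ?_, key⟩
    have := key (fun _ => 1)
    simp only [mul_one] at this
    rw [← this]
    simp only [walkE, hF, mul_one, hsum, Finset.sum_const, nsmul_eq_mul]
    field_simp

theorem walkE_const {S : Finset G} (hS : S.Nonempty) (l : ℕ) (c : ℝ) :
    walkE S l (fun _ => c) = c := by
  obtain ⟨B, w, -, h1, h⟩ := walkE_eq_sum hS l
  rw [h, ← Finset.sum_mul, h1, one_mul]

theorem walkE_mono {S : Finset G} (hS : S.Nonempty) (l : ℕ) {F F' : G → ℝ}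
    (hF : ∀ g, F g ≤ F' g) : walkE S l F ≤ walkE S l F' := by
  obtain ⟨B, w, hw, -, h⟩ := walkE_eq_sum hS l
  rw [h, h]
  exact Finset.sum_le_sum fun g _ => mul_le_mul_of_nonneg_left (hF g) (hw g)

theorem walkE_nonneg {S : Finset G} (hS : S.Nonempty) (l : ℕ) {F : G → ℝ}
    (hF : ∀ g, 0 ≤ F g) : 0 ≤ walkE S l F := by
  simpa [walkE_const hS] using walkE_mono hS l (F := fun _ => 0) hF

theorem walkE_add_fun {S : Finset G} (hS : S.Nonempty) (l : ℕ) (F F' : G → ℝ) :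
    walkE S l (fun g => F g + F' g) = walkE S l F + walkE S l F' := by
  obtain ⟨B, w, -, -, h⟩ := walkE_eq_sum hS l
  simp only [h, mul_add, Finset.sum_add_distrib]

theorem walkE_sum {S : Finset G} (hS : S.Nonempty) (l : ℕ) {ι : Type*} (s : Finset ι)
    (F : ι → G → ℝ) : walkE S l (fun g => ∑ i ∈ s, F i g) = ∑ i ∈ s, walkE S l (F i) := by
  obtain ⟨B, w, -, -, h⟩ := walkE_eq_sum hS l
  simp only [h, Finset.mul_sum]
  exact Finset.sum_comm

theorem walkE_const_mul {S : Finset G} (hS : S.Nonempty) (l : ℕ) (c : ℝ) (F : G → ℝ) :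
    walkE S l (fun g => c * F g) = c * walkE S l F := by
  obtain ⟨B, w, -, -, h⟩ := walkE_eq_sum hS l
  simp only [h, Finset.mul_sum]
  exact Finset.sum_congr rfl fun _ _ => by ring

theorem walkE_comm {S : Finset G} (hS : S.Nonempty) (l m : ℕ) (F : G → G → ℝ) :
    walkE S l (fun h => walkE S m (fun k => F h k)) =
      walkE S m (fun k => walkE S l (fun h => F h k)) := by
  obtain ⟨B, w, -, -, h⟩ := walkE_eq_sum hS m
  simp only [h]
  rw [walkE_sum hS]
  exact Finset.sum_congr rfl fun _ _ => walkE_const_mul hS _ _ _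

theorem walkE_sq_le {S : Finset G} (hS : S.Nonempty) (l : ℕ) (F : G → ℝ) :
    walkE S l F ^ 2 ≤ walkE S l (fun g => F g ^ 2) := by
  obtain ⟨B, w, hw, h1, h⟩ := walkE_eq_sum hS l
  simp only [h]
  exact Real.pow_arith_mean_le_arith_mean_pow_of_even B w F (fun i _ => hw i) h1 even_two

theorem walkE_add {S : Finset G} (hS : S.Nonempty) (l m : ℕ) (F : G → ℝ) :
    walkE S (l + m) F = walkE S l (fun h => walkE S m (fun k => F (h * k))) := by
  induction m generalizing F with
  | zero => simp [walkE]
  | succ m ih =>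
    rw [← add_assoc]
    simp only [walkE, ih, mul_assoc]
    rw [walkE_const_mul hS, walkE_sum hS]

theorem walkE_inv {S : Finset G} (hS : S.Nonempty) (hsym : ∀ s, s ∈ S → s⁻¹ ∈ S) (l : ℕ)
    (F : G → ℝ) : walkE S l (fun g => F g⁻¹) = walkE S l F := by
  induction l generalizing F with
  | zero => simp [walkE]
  | succ l ih =>
    have h : walkE S (1 + l) F = (S.card : ℝ)⁻¹ * ∑ s ∈ S, walkE S l (fun g => F (s * g)) := by
      rw [walkE_add hS]
      simp [walkE]
    rw [add_comm l 1, h, add_comm 1 l]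
    simp only [walkE]
    congr 1
    refine Finset.sum_nbij' (fun s => s⁻¹) (fun s => s⁻¹) hsym hsym (by simp) (by simp) ?_
    intro s _
    rw [← ih]
    simp only [_root_.mul_inv_rev, inv_inv]

theorem le_walkE_of_mem_pow {S : Finset G} (hS : S.Nonempty) {l : ℕ} {g : G}
    (hg : g ∈ (S : Set G) ^ l) {F : G → ℝ} (hF : ∀ g, 0 ≤ F g) :
    ((S.card : ℝ)⁻¹) ^ l * F g ≤ walkE S l F := by
  induction l generalizing F g with
  | zero =>
    simp only [pow_zero, Set.mem_one] at hg
    simp [walkE, hg]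
  | succ l ih =>
    rw [pow_succ] at hg
    obtain ⟨h, hh, s, hs, rfl⟩ := Set.mem_mul.1 hg
    have h1 := ih hh (F := fun g => F (g * s)) (fun g => hF _)
    have h2 : walkE S l (fun g => F (g * s)) ≤ ∑ s ∈ S, walkE S l (fun g => F (g * s)) :=
      Finset.single_le_sum (f := fun s => walkE S l (fun g => F (g * s)))
        (fun s _ => walkE_nonneg hS l fun g => hF _) hs
    calc ((S.card : ℝ)⁻¹) ^ (l + 1) * F (h * s)
        = (S.card : ℝ)⁻¹ * (((S.card : ℝ)⁻¹) ^ l * F (h * s)) := by ring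
      _ ≤ _ := mul_le_mul_of_nonneg_left (h1.trans h2) (by positivity)

end Walk

/-- A sequence bounded above by a decaying geometric sequence. -/
def ExpDecay (b : ℕ → ℝ) : Prop := ∃ C ρ : ℝ, 0 ≤ C ∧ 0 < ρ ∧ ρ < 1 ∧ ∀ l, b l ≤ C * ρ ^ l

theorem ExpDecay.mono {a b : ℕ → ℝ} (hb : ExpDecay b) (h : ∀ l, a l ≤ b l) : ExpDecay a := by
  obtain ⟨C, ρ, hC, h0, h1, hl⟩ := hb
  exact ⟨C, ρ, hC, h0, h1, fun l => (h l).trans (hl l)⟩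

theorem ExpDecay.add {a b : ℕ → ℝ} (ha : ExpDecay a) (hb : ExpDecay b) :
    ExpDecay (fun l => a l + b l) := by
  obtain ⟨C, ρ, hC, h0, h1, hl⟩ := ha
  obtain ⟨C', ρ', hC', h0', h1', hl'⟩ := hb
  refine ⟨C + C', max ρ ρ', by positivity, lt_max_of_lt_left h0, max_lt h1 h1', fun l => ?_⟩
  rw [add_mul]
  refine add_le_add ((hl l).trans ?_) ((hl' l).trans ?_)
  · gcongr; exact le_max_left _ _
  · gcongr; exact le_max_right _ _

theorem ExpDecay.sum {ι : Type*} (s : Finset ι) {b : ι → ℕ → ℝ} (hb : ∀ i, ExpDecay (b i)) :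
    ExpDecay (fun l => ∑ i ∈ s, b i l) := by
  classical
  induction s using Finset.induction_on with
  | empty => exact ⟨0, 1 / 2, le_rfl, by norm_num, by norm_num, by simp⟩
  | insert i s hi ih => simpa [Finset.sum_insert hi] using (hb i).add ih

theorem ExpDecay.sqrt {b : ℕ → ℝ} (hb : ExpDecay b) : ExpDecay (fun l => √(b l)) := by
  obtain ⟨C, ρ, hC, h0, h1, hl⟩ := hb
  refine ⟨√C, √ρ, by positivity, by positivity, by rw [Real.sqrt_lt' one_pos]; simpa, fun l => ?_⟩
  refine (Real.sqrt_le_sqrt (hl l)).trans_eq ?_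
  rw [Real.sqrt_mul hC]
  congr 1
  rw [Real.sqrt_eq_iff_eq_sq (by positivity) (by positivity), ← pow_mul, mul_comm, pow_mul,
    Real.sq_sqrt h0.le]

theorem expDecay_div {b : ℕ → ℝ} (hb : ExpDecay b) {m : ℕ} (hm : 0 < m) :
    ExpDecay (fun l => b (l / m)) := by
  obtain ⟨C, ρ, hC, h0, h1, hl⟩ := hb
  have hm' : (0 : ℝ) < m := by exact_mod_cast hm
  set σ := ρ ^ ((m : ℝ)⁻¹) with hσ
  have hσ0 : 0 < σ := Real.rpow_pos_of_pos h0 _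
  have hσ1 : σ < 1 := Real.rpow_lt_one h0.le h1 (by positivity)
  have hσm : σ ^ m = ρ := Real.rpow_inv_natCast_pow h0.le hm.ne'
  refine ⟨C * (σ ^ m)⁻¹, σ, by positivity, hσ0, hσ1, fun l => (hl _).trans ?_⟩
  rw [mul_assoc]
  refine mul_le_mul_of_nonneg_left ?_ hC
  rw [← hσm, ← pow_mul, le_inv_mul_iff₀ (by positivity), ← pow_add]
  refine pow_le_pow_of_le_one hσ0.le hσ1.le ?_
  have h1 := Nat.div_add_mod l m
  have h2 := Nat.mod_lt l hm
  omega

section Return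

variable {G X : Type*} [Group G] [MulAction G X]

open Classical in
/-- The probability that the walk takes `x` to `y` in `l` steps. -/
noncomputable def hitProb (S : Finset G) (l : ℕ) (x y : X) : ℝ :=
  walkE S l (fun g => if g • x = y then 1 else 0)

open Classical in
theorem exists_orbit_distribution {S : Finset G} (hS : S.Nonempty) (l : ℕ) (x y : X) :
    ∃ (Z : Finset X) (u : X → X → ℝ), (∀ p ∈ Z, ∃ g : G, p = g • x ∨ p = g • y) ∧
      ∀ a b, (a = x ∨ a = y) → (b = x ∨ b = y) → ∀ g : G,
        walkE S l (fun h => walkE S l (fun k => if g • k • a = h • b then 1 else 0)) =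
          ∑ p ∈ Z, ∑ q ∈ Z, u a p * u b q * (if g • p = q then 1 else 0) := by
  obtain ⟨B, w, hw, h1, h⟩ := walkE_eq_sum hS l
  refine ⟨B.image (fun g => g • x) ∪ B.image (fun g => g • y),
    fun a p => ∑ k ∈ B, w k * (if k • a = p then 1 else 0), ?_, ?_⟩
  · intro p hp
    simp only [Finset.mem_union, Finset.mem_image] at hp
    rcases hp with ⟨g, -, rfl⟩ | ⟨g, -, rfl⟩
    exacts [⟨g, Or.inl rfl⟩, ⟨g, Or.inr rfl⟩]
  · intro a b ha hb g
    set Z := B.image (fun g => g • x) ∪ B.image (fun g => g • y) with hZ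
    have hmem : ∀ c, (c = x ∨ c = y) → ∀ k ∈ B, k • c ∈ Z := by
      intro c hc k hk
      rw [hZ, Finset.mem_union, Finset.mem_image, Finset.mem_image]
      rcases hc with rfl | rfl
      exacts [Or.inl ⟨k, hk, rfl⟩, Or.inr ⟨k, hk, rfl⟩]
    have e1 : ∀ p q, (∑ k ∈ B, w k * (if k • a = p then (1 : ℝ) else 0)) *
        (∑ h ∈ B, w h * (if h • b = q then (1 : ℝ) else 0)) * (if g • p = q then 1 else 0) =
        ∑ h ∈ B, ∑ k ∈ B, w h * (w k * ((if k • a = p then 1 else 0) *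
          (if h • b = q then 1 else 0) * (if g • p = q then 1 else 0))) := by
      intro p q
      rw [Finset.sum_mul_sum, Finset.sum_comm, Finset.sum_mul]
      refine Finset.sum_congr rfl fun h _ => ?_
      rw [Finset.sum_mul]
      exact Finset.sum_congr rfl fun k _ => by ring
    simp only [h, e1]
    simp only [Finset.mul_sum]
    have e2 : ∀ f : X → X → G → G → ℝ, ∑ p ∈ Z, ∑ q ∈ Z, ∑ h ∈ B, ∑ k ∈ B, f p q h k =
        ∑ h ∈ B, ∑ k ∈ B, ∑ p ∈ Z, ∑ q ∈ Z, f p q h k := by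
      intro f
      calc _ = ∑ pq ∈ Z ×ˢ Z, ∑ hk ∈ B ×ˢ B, f pq.1 pq.2 hk.1 hk.2 := by
            simp only [Finset.sum_product]
        _ = _ := by
            rw [Finset.sum_comm]
            simp only [Finset.sum_product]
    rw [e2]
    refine Finset.sum_congr rfl fun h hh => Finset.sum_congr rfl fun k hk => ?_
    simp only [← Finset.mul_sum]
    congr 2
    rw [Finset.sum_eq_single_of_mem _ (hmem a ha k hk), Finset.sum_eq_single_of_mem _
      (hmem b hb h hh)]
    · simp
    · intro q _ hq
      simp [hq.symm]
    · intro p _ hp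
      simp [hp.symm]

open Classical in
theorem hitProb_add {S : Finset G} (hS : S.Nonempty) (hsym : ∀ s, s ∈ S → s⁻¹ ∈ S) (l : ℕ)
    (x y : X) : hitProb S (l + l) x y =
      walkE S l (fun h => walkE S l (fun k => if (1 : G) • k • x = h • y then 1 else 0)) := by
  rw [hitProb, walkE_add hS, ← walkE_inv hS hsym]
  simp only [mul_smul, one_smul, inv_smul_eq_iff]

/-- Schur's test for a symmetric form on a finite set. -/
theorem schur_test {Z : Finset X} (u : X → ℝ) (M c : X → X → ℝ) (hM : ∀ p q, 0 ≤ M p q)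
    (hMs : ∀ p q, M p q = M q p) (hc0 : ∀ p q, 0 < c p q) (hc : ∀ p q, c p q * c q p = 1) (K : ℝ)
    (hK : ∀ p ∈ Z, ∑ q ∈ Z, M p q * c p q ≤ K) :
    ∑ p ∈ Z, ∑ q ∈ Z, u p * u q * M p q ≤ K * ∑ p ∈ Z, u p ^ 2 := by
  have h1 : ∀ p q, u p * u q * M p q ≤
      1 / 2 * (u p ^ 2 * (M p q * c p q)) + 1 / 2 * (u q ^ 2 * (M q p * c q p)) := by
    intro p q
    have h2 : u p * u q ≤ 1 / 2 * (u p ^ 2 * c p q) + 1 / 2 * (u q ^ 2 * c q p) := by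
      have h3 : 0 ≤ c q p * (u p * c p q - u q) ^ 2 := mul_nonneg (hc0 _ _).le (sq_nonneg _)
      have h4 : c q p * (u p * c p q - u q) ^ 2 =
          u p ^ 2 * c p q * (c p q * c q p) - 2 * (u p * u q) * (c p q * c q p) + u q ^ 2 * c q p := by
        ring
      rw [h4, hc] at h3
      linarith
    have := mul_le_mul_of_nonneg_right h2 (hM p q)
    rw [hMs q p]
    linarith
  calc ∑ p ∈ Z, ∑ q ∈ Z, u p * u q * M p q
      ≤ ∑ p ∈ Z, ∑ q ∈ Z,
        (1 / 2 * (u p ^ 2 * (M p q * c p q)) + 1 / 2 * (u q ^ 2 * (M q p * c q p))) :=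
        Finset.sum_le_sum fun p _ => Finset.sum_le_sum fun q _ => h1 p q
    _ = ∑ p ∈ Z, u p ^ 2 * ∑ q ∈ Z, M p q * c p q := by
        simp only [Finset.sum_add_distrib]
        rw [Finset.sum_comm (f := fun p q => 1 / 2 * (u q ^ 2 * (M q p * c q p)))]
        rw [← Finset.sum_add_distrib]
        refine Finset.sum_congr rfl fun p _ => ?_
        rw [← Finset.sum_add_distrib, Finset.mul_sum]
        exact Finset.sum_congr rfl fun q _ => by ring
    _ ≤ ∑ p ∈ Z, u p ^ 2 * K :=
        Finset.sum_le_sum fun p hp => mul_le_mul_of_nonneg_left (hK p hp) (sq_nonneg _)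
    _ = _ := by rw [← Finset.sum_mul, mul_comm]

open Classical in
theorem hitProb_le {S : Finset G} (hS : S.Nonempty) (hsym : ∀ s, s ∈ S → s⁻¹ ∈ S) (l : ℕ)
    (x y : X) : hitProb S (l + l) x y ≤ hitProb S (l + l) x x + hitProb S (l + l) y y := by
  obtain ⟨Z, u, -, h⟩ := exists_orbit_distribution hS l x y
  rw [hitProb_add hS hsym, hitProb_add hS hsym, hitProb_add hS hsym, h x y (by simp) (by simp),
    h x x (by simp) (by simp), h y y (by simp) (by simp)]
  simp only [one_smul, mul_ite, mul_one, mul_zero, Finset.sum_ite_eq, Finset.sum_ite_mem]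
  rw [← Finset.sum_add_distrib]
  refine Finset.sum_le_sum fun p hp => ?_
  nlinarith [sq_nonneg (u x p - u y p), sq_nonneg (u x p + u y p)]

open Classical in
/-- If, on an invariant set, each of `12` elements and each of their inverses increases `N` at
every point with at most three exceptions, then return probabilities decay exponentially. -/
theorem hitProb_expDecay {S : Finset G} (hS : S.Nonempty) (hsym : ∀ s, s ∈ S → s⁻¹ ∈ S) {m : ℕ}
    (hm : 0 < m) (t : Fin 12 → G) (ht : ∀ r, t r ∈ (S : Set G) ^ (2 * m))
    (Y : Set X)
    (hY : ∀ (g : G), ∀ x ∈ Y, g • x ∈ Y) (N : X → ℝ)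
    (hN : ∀ x ∈ Y, (Finset.univ.filter fun r => N (t r • x) ≤ N x).card ≤ 3)
    (hN' : ∀ x ∈ Y, (Finset.univ.filter fun r => N ((t r)⁻¹ • x) ≤ N x).card ≤ 3) :
    ∃ b, ExpDecay b ∧ ∀ x ∈ Y, ∀ l, hitProb S (l + l) x x ≤ b l := by
  have hcard : (0 : ℝ) < S.card := by exact_mod_cast hS.card_pos
  have hcard1 : (1 : ℝ) ≤ S.card := by exact_mod_cast hS.card_pos
  set ε : ℝ := ((S.card : ℝ)⁻¹) ^ (2 * m) with hε
  have hε0 : 0 < ε := by positivity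
  have hε1 : ε ≤ 1 := pow_le_one₀ (by positivity) (inv_le_one_of_one_le₀ hcard1)
  have hr1 : ∀ (x : X) l, hitProb S l x x ≤ 1 := by
    intro x l
    rw [hitProb]
    refine (walkE_mono hS l (F' := fun _ => 1) fun g => ?_).trans_eq (walkE_const hS l 1)
    split_ifs <;> norm_num
  have step : ∀ x ∈ Y, ∀ l, hitProb S ((l + m) + (l + m)) x x ≤
      (1 - ε / 8) * hitProb S (l + l) x x := by
    intro x hx l
    obtain ⟨Z, u, hZ, hu⟩ := exists_orbit_distribution hS l x x
    have hZY : ∀ p ∈ Z, p ∈ Y := by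
      intro p hp
      obtain ⟨g, rfl | rfl⟩ := hZ p hp <;> exact hY g x hx
    set Q : G → ℝ := fun g => ∑ p ∈ Z, ∑ q ∈ Z, u x p * u x q * (if g • p = q then 1 else 0)
      with hQ
    set R := ∑ p ∈ Z, u x p ^ 2 with hR
    have hr : hitProb S (l + l) x x = R := by
      rw [hitProb_add hS hsym, hu x x (by simp) (by simp)]
      simp only [one_smul, mul_ite, mul_one, mul_zero, Finset.sum_ite_eq]
      exact Finset.sum_congr rfl fun p hp => by simp [hp, sq]
    have hR0 : 0 ≤ R := Finset.sum_nonneg fun _ _ => sq_nonneg _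
    have hstep : hitProb S ((l + m) + (l + m)) x x = walkE S (2 * m) Q := by
      rw [hitProb, show (l + m) + (l + m) = l + (2 * m + l) by ring, walkE_add hS]
      simp only [walkE_add hS (2 * m) l]
      rw [← walkE_inv hS hsym, walkE_comm hS]
      congr 1
      funext g
      rw [hQ]
      simp only []
      rw [← hu x x (by simp) (by simp) g]
      simp only [mul_smul, inv_smul_eq_iff]
    have hQinv : ∀ g, Q g⁻¹ = Q g := by
      intro g
      simp only [hQ]
      rw [Finset.sum_comm]
      refine Finset.sum_congr rfl fun p _ => Finset.sum_congr rfl fun q _ => ?_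
      rw [inv_smul_eq_iff, eq_comm (a := q), mul_comm (u x q)]
    have hQR : ∀ g, Q g ≤ R := by
      intro g
      have h2 : Q g + Q g⁻¹ ≤ 2 * R := by
        have := schur_test (Z := Z) (u x)
          (fun p q => (if g • p = q then 1 else 0) + (if g⁻¹ • p = q then 1 else 0))
          (fun _ _ => 1) (fun p q => by positivity)
          (fun p q => by
            rw [add_comm, inv_smul_eq_iff, inv_smul_eq_iff, eq_comm (a := p), eq_comm (a := q)])
          (by simp) (by simp) 2 (fun p _ => by
            simp only [mul_one, Finset.sum_add_distrib, Finset.sum_ite_eq]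
            split_ifs <;> norm_num)
        simpa only [mul_add, Finset.sum_add_distrib] using this
      rw [hQinv] at h2
      linarith
    set c : X → X → ℝ := fun p q => if N p < N q then 1 / 2 else if N q < N p then 2 else 1 with hcdef
    have hc_le : ∀ p q, c p q ≤ 1 / 2 + (3 / 2) * (if N q ≤ N p then 1 else 0) := by
      intro p q
      simp only [hcdef]
      split_ifs <;> linarith
    have hsum : ∑ r, Q (t r) ≤ 21 / 2 * R := by
      have := schur_test (Z := Z) (u x)
        (fun p q => ∑ r, ((if t r • p = q then 1 else 0) + (if (t r)⁻¹ • p = q then 1 else 0))) c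
        (fun p q => Finset.sum_nonneg fun r _ => by positivity)
        (fun p q => Finset.sum_congr rfl fun r _ => by
          rw [add_comm, inv_smul_eq_iff, inv_smul_eq_iff, eq_comm (a := p), eq_comm (a := q)])
        (fun p q => by simp only [hcdef]; split_ifs <;> norm_num)
        (fun p q => by
          simp only [hcdef]
          split_ifs <;> first | (exfalso; linarith) | norm_num) 21 (fun p hp => by
            have h3 : ∀ g : G, ∑ q ∈ Z, (if g • p = q then 1 else 0) * c p q ≤
                1 / 2 + (3 / 2) * (if N (g • p) ≤ N p then 1 else 0) := by
              intro g
              simp only [ite_mul, one_mul, zero_mul, Finset.sum_ite_eq]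
              refine le_trans ?_ (hc_le p (g • p))
              split_ifs
              · exact le_rfl
              · simp only [hcdef]; split_ifs <;> norm_num
            simp only [Finset.sum_mul, add_mul]
            rw [Finset.sum_comm]
            simp only [Finset.sum_add_distrib]
            have h4 : ∑ r, ∑ q ∈ Z, (if t r • p = q then 1 else 0) * c p q ≤ 21 / 2 := by
              refine (Finset.sum_le_sum fun r _ => h3 (t r)).trans ?_
              rw [Finset.sum_add_distrib, ← Finset.mul_sum, Finset.sum_boole]
              have : ((Finset.univ.filter fun r => N (t r • p) ≤ N p).card : ℝ) ≤ 3 := by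
                exact_mod_cast hN p (hZY p hp)
              norm_num
              linarith
            have h5 : ∑ r, ∑ q ∈ Z, (if (t r)⁻¹ • p = q then 1 else 0) * c p q ≤ 21 / 2 := by
              refine (Finset.sum_le_sum fun r _ => h3 (t r)⁻¹).trans ?_
              rw [Finset.sum_add_distrib, ← Finset.mul_sum, Finset.sum_boole]
              have : ((Finset.univ.filter fun r => N ((t r)⁻¹ • p) ≤ N p).card : ℝ) ≤ 3 := by
                exact_mod_cast hN' p (hZY p hp)
              norm_num
              linarith
            linarith)
      have h6 : ∑ r, (Q (t r) + Q (t r)⁻¹) ≤ 21 * R := by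
        refine le_trans (le_of_eq ?_) this
        simp only [hQ, Finset.mul_sum, mul_add, Finset.sum_add_distrib]
        congr 1
        · rw [Finset.sum_comm]
          exact Finset.sum_congr rfl fun p _ => Finset.sum_comm
        · rw [Finset.sum_comm]
          exact Finset.sum_congr rfl fun p _ => Finset.sum_comm
      simp only [hQinv, Finset.sum_add_distrib] at h6
      linarith
    have h7 : ∀ r, ε * (R - Q (t r)) ≤ R - walkE S (2 * m) Q := by
      intro r
      refine (le_walkE_of_mem_pow hS (ht r) (F := fun g => R - Q g)
        (fun g => sub_nonneg.2 (hQR g))).trans_eq ?_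
      have := walkE_add_fun hS (2 * m) (fun _ => R) (fun g => (-1) * Q g)
      rw [walkE_const hS, walkE_const_mul hS] at this
      simpa [sub_eq_add_neg] using this
    have h8 := Finset.sum_le_sum fun r (_ : r ∈ (Finset.univ : Finset (Fin 12))) => h7 r
    rw [← Finset.mul_sum, Finset.sum_sub_distrib] at h8
    simp only [Finset.sum_const, Finset.card_univ, Fintype.card_fin, nsmul_eq_mul] at h8
    rw [hstep, hr]
    push_cast at h8
    have h9 := mul_le_mul_of_nonneg_left hsum hε0.le
    linarith
  refine ⟨fun l => (1 - ε / 8) ^ (l / m), expDecay_div (b := fun l => (1 - ε / 8) ^ l)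
    ⟨1, 1 - ε / 8, zero_le_one, by linarith, by linarith, by simp⟩ hm, fun x hx => ?_⟩
  have hdiv : ∀ k j, hitProb S ((k * m + j) + (k * m + j)) x x ≤ (1 - ε / 8) ^ k := by
    intro k j
    induction k with
    | zero => simpa using hr1 x _
    | succ k ih =>
      have := step x hx (k * m + j)
      rw [show (k + 1) * m + j = k * m + j + m by ring, pow_succ']
      exact this.trans (mul_le_mul_of_nonneg_left ih (by linarith))
  intro l
  have := hdiv (l / m) (l % m)
  rwa [Nat.div_add_mod'] at this

end Return

/-- The three projections of `Γ` to `SL₂(ℤ)`. -/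
def coord (i : Fin 3) : GammaSL →* SL2Z :=
  ![MonoidHom.fst SL2Z (SL2Z × SL2Z),
    (MonoidHom.fst SL2Z SL2Z).comp (MonoidHom.snd SL2Z (SL2Z × SL2Z)),
    (MonoidHom.snd SL2Z SL2Z).comp (MonoidHom.snd SL2Z (SL2Z × SL2Z))] i

/-- The three inclusions of `SL₂(ℤ)` in `Γ`. -/
def incl (i : Fin 3) : SL2Z →* GammaSL :=
  ![MonoidHom.inl SL2Z (SL2Z × SL2Z),
    (MonoidHom.inr SL2Z (SL2Z × SL2Z)).comp (MonoidHom.inl SL2Z SL2Z),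
    (MonoidHom.inr SL2Z (SL2Z × SL2Z)).comp (MonoidHom.inr SL2Z SL2Z)] i

theorem coord_incl_self (i : Fin 3) (u : SL2Z) : coord i (incl i u) = u := by
  fin_cases i <;> rfl

theorem coord_incl_of_ne {i j : Fin 3} (h : j ≠ i) (u : SL2Z) : coord j (incl i u) = 1 := by
  fin_cases i <;> fin_cases j <;> first | rfl | exact absurd rfl h

theorem incl_mul_incl_mul_incl (g : GammaSL) :
    incl 0 (coord 0 g) * incl 1 (coord 1 g) * incl 2 (coord 2 g) = g := by
  obtain ⟨a, b, c⟩ := g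
  simp [incl, coord]

/-- The `i`-th component of an element of `Γ`, as a matrix over `R`. -/
def mat (R : Type*) [CommRing R] (i : Fin 3) : GammaSL →* Matrix (Fin 2) (Fin 2) R where
  toFun g := (coord i g : Matrix (Fin 2) (Fin 2) ℤ).map (Int.castRingHom R)
  map_one' := by simp
  map_mul' g h := by
    rw [map_mul]
    exact (Int.castRingHom R).mapMatrix.map_mul _ _

theorem mat_apply (R : Type*) [CommRing R] (i : Fin 3) (g : GammaSL) (a b : Fin 2) :
    mat R i g a b = ((coord i g a b : ℤ) : R) := rfl

theorem mat_apply_eq_entryZ (R : Type*) [CommRing R] (i : Fin 3) (g : GammaSL) (a b : Fin 2) :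
    mat R i g a b = (entryZ g (i, a, b) : R) := by
  fin_cases i <;> rfl

theorem mat_mul_inv {R : Type*} [CommRing R] (i : Fin 3) (g : GammaSL) :
    mat R i g * mat R i g⁻¹ = 1 := by rw [← map_mul, mul_inv_cancel, map_one]

theorem mat_inv_mul {R : Type*} [CommRing R] (i : Fin 3) (g : GammaSL) :
    mat R i g⁻¹ * mat R i g = 1 := by rw [← map_mul, inv_mul_cancel, map_one]

theorem mat_inv {R : Type*} [CommRing R] (i : Fin 3) (g : GammaSL) :
    mat R i g⁻¹ = (mat R i g).adjugate := by
  ext a b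
  rw [mat_apply, map_inv, SpecialLinearGroup.SL2_inv_expl, adjugate_fin_two]
  fin_cases a <;> fin_cases b <;> simp [mat_apply]

/-- Elementary unipotent matrices, upper triangular for `true`. -/
def unip : Bool → ℤ → SL2Z
  | true, n => ⟨!![1, n; 0, 1], by simp [det_fin_two]⟩
  | false, n => ⟨!![1, 0; n, 1], by simp [det_fin_two]⟩

theorem unip_inv (e : Bool) (n : ℤ) : (unip e n)⁻¹ = unip e (-n) := by
  rw [SpecialLinearGroup.SL2_inv_expl]
  cases e <;> simp [unip] <;> rfl

theorem unip_zero (e : Bool) : unip e 0 = 1 := by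
  apply Subtype.ext
  cases e <;> simp [unip, one_fin_two]

theorem closure_unip : Subgroup.closure {u | ∃ e n, u = unip e n} = (⊤ : Subgroup SL2Z) := by
  rw [eq_top_iff, ← SpecialLinearGroup.SL2Z_generators, Subgroup.closure_le]
  have hmem : ∀ e n, unip e n ∈ Subgroup.closure {u | ∃ e n, u = unip e n} :=
    fun e n => Subgroup.subset_closure ⟨e, n, rfl⟩
  rintro x (rfl | rfl)
  · have : ModularGroup.S = unip true (-1) * unip false 1 * unip true (-1) := by
      decide
    rw [this]
    exact mul_mem (mul_mem (hmem _ _) (hmem _ _)) (hmem _ _)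
  · exact hmem true 1

theorem closure_incl_unip :
    Subgroup.closure {g | ∃ i e n, g = incl i (unip e n)} = (⊤ : Subgroup GammaSL) := by
  rw [eq_top_iff]
  intro g _
  have h : ∀ i u, incl i u ∈ Subgroup.closure {g | ∃ i e n, g = incl i (unip e n)} := by
    intro i u
    have : Subgroup.closure {u | ∃ e n, u = unip e n} ≤
        (Subgroup.closure {g | ∃ i e n, g = incl i (unip e n)}).comap (incl i) := by
      rw [Subgroup.closure_le]
      rintro _ ⟨e, n, rfl⟩
      exact Subgroup.subset_closure ⟨i, e, n, rfl⟩
    rw [closure_unip] at this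
    exact this (Subgroup.mem_top u)
  rw [← incl_mul_incl_mul_incl g]
  exact mul_mem (mul_mem (h _ _) (h _ _)) (h _ _)

/-- The real polynomial functions in the matrix entries on `Γ`. -/
noncomputable def polyFun : Subalgebra ℝ (GammaSL → ℝ) :=
  Algebra.adjoin ℝ (Set.range fun (x : Fin 3 × Fin 2 × Fin 2) (g : GammaSL) => (entryZ g x : ℝ))

theorem mat_mem_polyFun (i : Fin 3) (a b : Fin 2) : (fun g => mat ℝ i g a b) ∈ polyFun :=
  Algebra.subset_adjoin ⟨(i, a, b), funext fun g => (mat_apply_eq_entryZ ℝ i g a b).symm⟩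

theorem const_mem_polyFun (c : ℝ) : (fun _ => c) ∈ polyFun := polyFun.algebraMap_mem c

theorem sum_mem_polyFun {ι : Type*} (s : Finset ι) {f : ι → GammaSL → ℝ}
    (h : ∀ i ∈ s, f i ∈ polyFun) : (fun g => ∑ i ∈ s, f i g) ∈ polyFun := by
  have := polyFun.sum_mem h
  convert this using 1
  ext g
  simp

theorem prod_mem_polyFun {ι : Type*} (s : Finset ι) {f : ι → GammaSL → ℝ}
    (h : ∀ i ∈ s, f i ∈ polyFun) : (fun g => ∏ i ∈ s, f i g) ∈ polyFun := by
  have := polyFun.prod_mem h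
  convert this using 1
  ext g
  simp

theorem mul_mem_polyFun {f f' : GammaSL → ℝ} (h : f ∈ polyFun) (h' : f' ∈ polyFun) :
    (fun g => f g * f' g) ∈ polyFun := polyFun.mul_mem h h'

theorem mat_inv_mem_polyFun (i : Fin 3) (a b : Fin 2) : (fun g => mat ℝ i g⁻¹ a b) ∈ polyFun := by
  simp only [mat_inv, adjugate_fin_two]
  have hneg : ∀ a b, (fun g => -mat ℝ i g a b) ∈ polyFun :=
    fun a b => polyFun.neg_mem (mat_mem_polyFun i a b)
  fin_cases a <;> fin_cases b <;> simp [mat_mem_polyFun, hneg]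

theorem polyFun_mul_right {f : GammaSL → ℝ} (hf : f ∈ polyFun) (h : GammaSL) :
    (fun g => f (g * h)) ∈ polyFun := by
  induction hf using Algebra.adjoin_induction with
  | mem f hf =>
    obtain ⟨⟨i, a, b⟩, rfl⟩ := hf
    simp only [← mat_apply_eq_entryZ, map_mul, mul_apply]
    exact sum_mem_polyFun _ fun c _ =>
      mul_mem_polyFun (mat_mem_polyFun _ _ _) (const_mem_polyFun _)
  | algebraMap r => exact const_mem_polyFun r
  | add f f' _ _ h1 h2 => exact polyFun.add_mem h1 h2
  | mul f f' _ _ h1 h2 => exact polyFun.mul_mem h1 h2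

theorem exists_polynomial_unip {f : GammaSL → ℝ} (hf : f ∈ polyFun) (γ : GammaSL) (i : Fin 3)
    (e : Bool) : ∃ p : Polynomial ℝ, ∀ n : ℤ, f (γ * incl i (unip e n)) = p.eval (n : ℝ) := by
  induction hf using Algebra.adjoin_induction with
  | mem f hf =>
    obtain ⟨⟨j, a, b⟩, rfl⟩ := hf
    simp only [← mat_apply_eq_entryZ, map_mul, mul_apply]
    by_cases hj : j = i
    · subst hj
      have h : ∀ c, ∃ p : Polynomial ℝ, ∀ n : ℤ, mat ℝ j (incl j (unip e n)) c b = p.eval (n : ℝ) := by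
        intro c
        simp only [mat_apply, coord_incl_self]
        cases e <;> fin_cases c <;> fin_cases b <;>
          first
          | (refine ⟨Polynomial.X, fun n => ?_⟩; simp [unip]; done)
          | (refine ⟨1, fun n => ?_⟩; simp [unip]; done)
          | (refine ⟨0, fun n => ?_⟩; simp [unip])
      choose p hp using h
      exact ⟨∑ c, Polynomial.C (mat ℝ j γ a c) * p c, fun n => by simp [hp]⟩
    · refine ⟨Polynomial.C (∑ c, mat ℝ j γ a c * (1 : Matrix (Fin 2) (Fin 2) ℝ) c b), fun n => ?_⟩
      have : mat ℝ j (incl i (unip e n)) = 1 := by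
        ext x y
        rw [mat_apply, coord_incl_of_ne hj]
        fin_cases x <;> fin_cases y <;> simp
      rw [this, Polynomial.eval_C]
  | algebraMap r => exact ⟨Polynomial.C r, fun n => by simp⟩
  | add f f' _ _ h1 h2 =>
    obtain ⟨p, hp⟩ := h1
    obtain ⟨q, hq⟩ := h2
    exact ⟨p + q, fun n => by simp [hp, hq]⟩
  | mul f f' _ _ h1 h2 =>
    obtain ⟨p, hp⟩ := h1
    obtain ⟨q, hq⟩ := h2
    exact ⟨p * q, fun n => by simp [hp, hq]⟩

/-- `Γ` is Zariski-irreducible. -/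
theorem exists_ne_zero_and_ne_zero {f f' : GammaSL → ℝ} (hf : f ∈ polyFun) (hf' : f' ∈ polyFun)
    (h : ∃ g, f g ≠ 0) (h' : ∃ g, f' g ≠ 0) : ∃ g, f g ≠ 0 ∧ f' g ≠ 0 := by
  have hunip : ∀ i e n η,
      (∀ f ∈ polyFun, ∀ f' ∈ polyFun, ∀ γ, f γ ≠ 0 → f' (γ * η) ≠ 0 → ∃ g, f g ≠ 0 ∧ f' g ≠ 0) →
      (∀ f ∈ polyFun, ∀ f' ∈ polyFun, ∀ γ, f γ ≠ 0 → f' (γ * (incl i (unip e n) * η)) ≠ 0 →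
        ∃ g, f g ≠ 0 ∧ f' g ≠ 0) := by
    intro i e n η hη f hf f' hf' γ h h'
    obtain ⟨p, hp⟩ := exists_polynomial_unip hf γ i e
    obtain ⟨q, hq⟩ := exists_polynomial_unip (polyFun_mul_right hf' η) γ i e
    have hp0 : p ≠ 0 := by
      rintro rfl
      have := hp 0
      rw [unip_zero, map_one, mul_one] at this
      simp [this] at h
    have hq0 : q ≠ 0 := by
      rintro rfl
      have := hq n
      rw [mul_assoc] at this
      simp [this] at h'
    have hpq : ∃ k : ℤ, (p * q).eval (k : ℝ) ≠ 0 := by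
      by_contra! hcon
      refine mul_ne_zero hp0 hq0 (Polynomial.eq_zero_of_infinite_isRoot _ ?_)
      refine Set.Infinite.mono (s := Set.range ((↑) : ℤ → ℝ)) ?_
        (Set.infinite_range_of_injective Int.cast_injective)
      rintro _ ⟨k, rfl⟩
      exact hcon k
    obtain ⟨k, hk⟩ := hpq
    rw [Polynomial.eval_mul, ← hp, ← hq] at hk
    exact hη f hf f' hf' (γ * incl i (unip e k)) (left_ne_zero_of_mul hk) (right_ne_zero_of_mul hk)
  have key : ∀ η : GammaSL, ∀ f ∈ polyFun, ∀ f' ∈ polyFun, ∀ γ, f γ ≠ 0 → f' (γ * η) ≠ 0 →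
      ∃ g, f g ≠ 0 ∧ f' g ≠ 0 := by
    intro η
    have hη : η ∈ Subgroup.closure {g | ∃ i e n, g = incl i (unip e n)} := by
      rw [closure_incl_unip]; trivial
    induction hη using Subgroup.closure_induction_left with
    | one =>
      intro f hf f' hf' γ h h'
      exact ⟨γ, h, by simpa using h'⟩
    | mul_left x hx y hy ih =>
      obtain ⟨i, e, n, rfl⟩ := hx
      exact hunip i e n y ih
    | inv_mul_cancel x hx y hy ih =>
      obtain ⟨i, e, n, rfl⟩ := hx
      rw [← map_inv, unip_inv]
      exact hunip i e (-n) y ih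
  obtain ⟨γ, hγ⟩ := h
  obtain ⟨γ', hγ'⟩ := h'
  exact key (γ⁻¹ * γ') f hf f' hf' γ hγ (by simpa using hγ')

theorem exists_prod_ne_zero {ι : Type*} (s : Finset ι) {f : ι → GammaSL → ℝ}
    (hf : ∀ i ∈ s, f i ∈ polyFun) (h : ∀ i ∈ s, ∃ g, f i g ≠ 0) : ∃ g, ∏ i ∈ s, f i g ≠ 0 := by
  classical
  induction s using Finset.induction_on with
  | empty => exact ⟨1, by simp⟩
  | insert i s hi ih =>
    obtain ⟨g, h1, h2⟩ := exists_ne_zero_and_ne_zero (hf i (by simp))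
      (prod_mem_polyFun s fun j hj => hf j (by simp [hj])) (h i (by simp))
      (ih (fun j hj => hf j (by simp [hj])) (fun j hj => h j (by simp [hj])))
    exact ⟨g, by rw [Finset.prod_insert hi]; exact mul_ne_zero h1 h2⟩

theorem exists_mem_ne_zero_of_zariskiDense {H : Subgroup GammaSL} (hH : ZariskiDense H)
    {f : GammaSL → ℝ} (hf : f ∈ polyFun) (h : ∃ g, f g ≠ 0) : ∃ g ∈ H, f g ≠ 0 := by
  by_contra! hcon
  obtain ⟨γ, hγ⟩ := h
  apply hγ
  rw [polyFun, Algebra.adjoin_range_eq_range_aeval] at hf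
  obtain ⟨P, rfl⟩ := hf
  have hev : ∀ g, (MvPolynomial.aeval (fun x (g : GammaSL) => (entryZ g x : ℝ)) P) g =
      ∑ d ∈ P.support, P.coeff d * ((∏ x, entryZ g x ^ d x : ℤ) : ℝ) := by
    intro g
    rw [MvPolynomial.aeval_def, MvPolynomial.eval₂_eq']
    simp
  refine (Module.forall_dual_apply_eq_zero_iff ℚ _).1 fun θ => ?_
  let Pθ : MvPolynomial (Fin 3 × Fin 2 × Fin 2) ℚ :=
    ∑ d ∈ P.support, MvPolynomial.monomial d (θ (P.coeff d))
  have hθ : ∀ g : GammaSL, MvPolynomial.aeval (fun x => (entryZ g x : ℂ)) Pθ =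
      ((θ (MvPolynomial.aeval (fun x (g : GammaSL) => (entryZ g x : ℝ)) P g) : ℚ) : ℂ) := by
    intro g
    have h1 : ∀ (r : ℝ) (n : ℤ), θ (r * n) = n * θ r := by
      intro r n
      rw [mul_comm, ← zsmul_eq_mul, map_zsmul, zsmul_eq_mul]
    rw [hev, map_sum, map_sum]
    simp only [h1, MvPolynomial.aeval_monomial]
    push_cast
    refine Finset.sum_congr rfl fun d _ => ?_
    rw [Finsupp.prod_fintype _ _ (by simp), mul_comm]
    simp
  have hz : ∀ g ∈ H, MvPolynomial.aeval (fun x => (entryZ g x : ℂ)) Pθ = 0 := by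
    intro g hg
    have := hcon g hg
    rw [hθ]
    erw [this]
    simp
  have hall := hH Pθ hz
    (SpecialLinearGroup.map (Int.castRingHom ℂ) γ.1, SpecialLinearGroup.map (Int.castRingHom ℂ) γ.2.1,
      SpecialLinearGroup.map (Int.castRingHom ℂ) γ.2.2)
  have he : entryC (SpecialLinearGroup.map (Int.castRingHom ℂ) γ.1,
      SpecialLinearGroup.map (Int.castRingHom ℂ) γ.2.1,
      SpecialLinearGroup.map (Int.castRingHom ℂ) γ.2.2) = fun x => (entryZ γ x : ℂ) := by
    funext ⟨i, a, b⟩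
    fin_cases i <;> rfl
  rw [he, hθ] at hall
  exact_mod_cast hall

open Filter Topology in
theorem eventually_card_filter_norm_le {E ι : Type*} [NormedAddCommGroup E] [NormedSpace ℝ E]
    [FiniteDimensional ℝ E] [Fintype ι] (D : Submodule ℝ E) {m : ℕ} {T : ℕ → ι → E → E}
    {L : ι → E → E} {s : ℕ → ℝ} (hs : Tendsto s atTop atTop)
    (hhom : ∀ k r (c : ℝ) X, T k r (c • X) = c • T k r X)
    (hT : ∀ r X, Tendsto (fun p : ℕ × E => (s p.1)⁻¹ • T p.1 r p.2) (atTop ×ˢ 𝓝 X) (𝓝 (L r X)))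
    (hL : ∀ X ∈ D, X ≠ 0 → ∀ J : Finset ι, (∀ r ∈ J, L r X = 0) → J.card ≤ m) :
    ∀ᶠ k in atTop, ∀ X ∈ D, X ≠ 0 → ∀ J : Finset ι, (∀ r ∈ J, ‖T k r X‖ ≤ ‖X‖) → J.card ≤ m := by
  have hK : IsCompact ((D : Set E) ∩ Metric.sphere 0 1) :=
    (isCompact_sphere (0 : E) 1).inter_left D.closed_of_finiteDimensional
  have hloc : ∀ X ∈ (D : Set E) ∩ Metric.sphere 0 1, ∀ᶠ p in (atTop : Filter ℕ) ×ˢ 𝓝 X,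
      ∀ r, L r X ≠ 0 → 1 < ‖T p.1 r p.2‖ := by
    intro X hX
    rw [eventually_all]
    intro r
    by_cases hr : L r X = 0
    · simp [hr]
    have h1 := ((hs.comp tendsto_fst).atTop_mul_pos (norm_pos_iff.2 hr) (hT r X).norm)
    filter_upwards [h1.eventually_gt_atTop 1,
      (hs.comp (tendsto_fst (f := atTop) (g := 𝓝 X))).eventually_gt_atTop 0] with p hp hp0 _
    simp only [Function.comp] at hp hp0
    rwa [norm_smul, norm_inv, Real.norm_of_nonneg hp0.le, ← mul_assoc, mul_inv_cancel₀ hp0.ne',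
      one_mul] at hp
  have hall : ∀ᶠ k in (atTop : Filter ℕ), ∀ X ∈ (D : Set E) ∩ Metric.sphere 0 1,
      ∀ J : Finset ι, (∀ r ∈ J, ‖T k r X‖ ≤ 1) → J.card ≤ m := by
    have : ∀ X ∈ (D : Set E) ∩ Metric.sphere 0 1, ∀ᶠ p in (atTop : Filter ℕ) ×ˢ 𝓝 X,
        ∀ J : Finset ι, (∀ r ∈ J, ‖T p.1 r p.2‖ ≤ 1) → J.card ≤ m := by
      intro X hX
      filter_upwards [hloc X hX] with p hp J hJ
      refine hL X hX.1 ?_ J fun r hr => ?_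
      · rintro rfl
        simpa using hX.2
      · by_contra hne
        exact absurd (hJ r hr) (not_le.2 (hp r hne))
    have h2 := hK.mem_prod_nhdsSet_of_forall this
    obtain ⟨A, hA, B, hB, hAB⟩ := Filter.mem_prod_iff.1 h2
    filter_upwards [hA] with k hk X hX
    exact hAB (Set.mk_mem_prod hk (subset_of_mem_nhdsSet hB hX))
  filter_upwards [hall] with k hk X hX hX0 J hJ
  have hn : 0 < ‖X‖ := norm_pos_iff.2 hX0
  refine hk (‖X‖⁻¹ • X) ⟨D.smul_mem _ hX, ?_⟩ J fun r hr => ?_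
  · simp [norm_smul, hn.ne']
  · rw [hhom, norm_smul, norm_inv, norm_norm, inv_mul_le_iff₀ hn, mul_one]
    exact hJ r hr

/-- Generic position: if each polynomial family of functionals `ℓ c` does not vanish identically
at any nonzero vector of `D`, then there are elements of a Zariski-dense group at which the
functionals are in general position. -/
theorem exists_generalPosition {E : Type*} [AddCommGroup E] [Module ℝ E] [FiniteDimensional ℝ E]
    {H : Subgroup GammaSL} (hH : ZariskiDense H) (D : Submodule ℝ E)
    (l : Bool → GammaSL → E →ₗ[ℝ] ℝ) (hpoly : ∀ c X, (fun g => l c g X) ∈ polyFun)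
    (hne : ∀ c, ∀ X ∈ D, X ≠ 0 → ∃ g, l c g X ≠ 0) (n : ℕ) :
    ∃ b : ℕ → GammaSL, (∀ r, b r ∈ H) ∧ ∀ c, ∀ J ⊆ Finset.range n,
      Module.finrank ℝ ↥(D ⊓ ⨅ r ∈ J, LinearMap.ker (l c (b r))) ≤
        Module.finrank ℝ D - J.card := by
  classical
  induction n with
  | zero =>
    refine ⟨fun _ => 1, fun _ => H.one_mem, fun c J hJ => ?_⟩
    obtain rfl : J = ∅ := by simpa using hJ
    exact (Submodule.finrank_mono inf_le_left).trans (by simp)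
  | succ n ih =>
    obtain ⟨b, hb, hJ⟩ := ih
    let U : Bool → Finset ℕ → Submodule ℝ E := fun c J => D ⊓ ⨅ r ∈ J, LinearMap.ker (l c (b r))
    have hx : ∀ c J, ∃ x ∈ U c J, U c J ≠ ⊥ → x ≠ 0 := by
      intro c J
      by_cases h : U c J = ⊥
      · exact ⟨0, zero_mem _, fun h' => absurd h h'⟩
      · obtain ⟨x, hx, h0⟩ := (Submodule.ne_bot_iff _).1 h
        exact ⟨x, hx, fun _ => h0⟩
    choose x hxU hx0 using hx
    let I : Finset (Bool × Finset ℕ) :=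
      (Finset.univ ×ˢ (Finset.range n).powerset).filter fun p => U p.1 p.2 ≠ ⊥
    have hI : ∀ p ∈ I, ∃ g, l p.1 g (x p.1 p.2) ≠ 0 := fun p hp =>
      hne _ _ (hxU p.1 p.2).1 (hx0 _ _ (Finset.mem_filter.1 hp).2)
    obtain ⟨g, hgH, hg⟩ := exists_mem_ne_zero_of_zariskiDense hH
      (prod_mem_polyFun I fun p _ => hpoly p.1 (x p.1 p.2))
      (exists_prod_ne_zero I (fun p _ => hpoly p.1 (x p.1 p.2)) hI)
    rw [Finset.prod_ne_zero_iff] at hg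
    have hU : ∀ c, ∀ J ⊆ Finset.range n, (⨅ r ∈ J, LinearMap.ker (l c (Function.update b n g r))) =
        ⨅ r ∈ J, LinearMap.ker (l c (b r)) := by
      intro c J hJ'
      refine iInf_congr fun r => iInf_congr fun hr => ?_
      have : r ≠ n := (Finset.mem_range.1 (hJ' hr)).ne
      rw [Function.update_of_ne this]
    refine ⟨Function.update b n g, fun r => ?_, fun c J hJ' => ?_⟩
    · by_cases hr : r = n
      · subst hr; simpa using hgH
      · simpa [hr] using hb r
    · by_cases hn : n ∈ J
      · have hsub : J.erase n ⊆ Finset.range n := by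
          intro r hr
          have := hJ' (Finset.mem_of_mem_erase hr)
          have h2 := Finset.ne_of_mem_erase hr
          simp at this ⊢
          omega
        rw [← Finset.insert_erase hn, Finset.iInf_insert, hU c _ hsub, Function.update_self,
          Finset.card_insert_of_notMem (Finset.notMem_erase _ _), inf_left_comm]
        have hle := hJ c _ hsub
        by_cases hbot : U c (J.erase n) = ⊥
        · have : D ⊓ ⨅ r ∈ J.erase n, LinearMap.ker (l c (b r)) = ⊥ := hbot
          rw [this, inf_bot_eq]
          simp
        · have hlt : LinearMap.ker (l c g) ⊓ (D ⊓ ⨅ r ∈ J.erase n, LinearMap.ker (l c (b r))) <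
              D ⊓ ⨅ r ∈ J.erase n, LinearMap.ker (l c (b r)) := by
            refine lt_of_le_of_ne inf_le_right fun heq => ?_
            have hmem : x c (J.erase n) ∈ D ⊓ ⨅ r ∈ J.erase n, LinearMap.ker (l c (b r)) := hxU _ _
            rw [← heq] at hmem
            exact hg (c, J.erase n) (by simp [I, hbot, Finset.mem_powerset, hsub])
              (LinearMap.mem_ker.1 hmem.1)
          have := Submodule.finrank_lt_finrank_of_lt hlt
          omega
      · have hsub : J ⊆ Finset.range n := by
          intro r hr
          have := hJ' hr
          have h2 : r ≠ n := fun h => hn (h ▸ hr)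
          simp at this ⊢
          omega
        rw [hU c J hsub]
        exact hJ c J hsub

theorem exists_card_filter_eq_zero_le {E : Type*} [AddCommGroup E] [Module ℝ E]
    [FiniteDimensional ℝ E] {H : Subgroup GammaSL} (hH : ZariskiDense H) (D : Submodule ℝ E)
    (l : Bool → GammaSL → E →ₗ[ℝ] ℝ) (hpoly : ∀ c X, (fun g => l c g X) ∈ polyFun)
    (hne : ∀ c, ∀ X ∈ D, X ≠ 0 → ∃ g, l c g X ≠ 0) (n : ℕ) :
    ∃ b : Fin n → GammaSL, (∀ r, b r ∈ H) ∧ ∀ c, ∀ X ∈ D, X ≠ 0 → ∀ J : Finset (Fin n),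
      (∀ r ∈ J, l c (b r) X = 0) → J.card < Module.finrank ℝ D := by
  obtain ⟨b, hb, h⟩ := exists_generalPosition hH D l hpoly hne n
  refine ⟨fun r => b r, fun r => hb r, fun c X hX hX0 J hJ => ?_⟩
  have h1 := h c (J.map Fin.valEmbedding) (by
    intro r hr
    obtain ⟨a, _, rfl⟩ := Finset.mem_map.1 hr
    simp)
  have hmem : X ∈ D ⊓ ⨅ r ∈ J.map Fin.valEmbedding, LinearMap.ker (l c (b r)) := by
    refine ⟨hX, ?_⟩
    simp only [Finset.mem_map, SetLike.mem_coe, Submodule.mem_iInf]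
    rintro _ ⟨a, ha, rfl⟩
    exact hJ a ha
  have h2 : 0 < Module.finrank ℝ
      ↥(D ⊓ ⨅ r ∈ J.map Fin.valEmbedding, LinearMap.ker (l c (b r))) := by
    have : Nontrivial ↥(D ⊓ ⨅ r ∈ J.map Fin.valEmbedding, LinearMap.ker (l c (b r))) :=
      ⟨⟨X, hmem⟩, 0, fun h => hX0 (congrArg Subtype.val h)⟩
    exact Module.finrank_pos
  rw [Finset.card_map] at h1
  omega

/-- The action `X ↦ gᵢ X gⱼ⁻¹` of `Γ` on real matrices. -/
noncomputable def pairAct (i j : Fin 3) (g : GammaSL) :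
    Matrix (Fin 2) (Fin 2) ℝ →ₗ[ℝ] Matrix (Fin 2) (Fin 2) ℝ :=
  LinearMap.mulLeft ℝ (mat ℝ i g) ∘ₗ LinearMap.mulRight ℝ (mat ℝ j g⁻¹)

theorem pairAct_apply (i j : Fin 3) (g : GammaSL) (X : Matrix (Fin 2) (Fin 2) ℝ) :
    pairAct i j g X = mat ℝ i g * X * mat ℝ j g⁻¹ := by
  simp [pairAct, mul_assoc]

theorem pairAct_one (i j : Fin 3) (X : Matrix (Fin 2) (Fin 2) ℝ) : pairAct i j 1 X = X := by
  simp [pairAct_apply]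

theorem pairAct_mul (i j : Fin 3) (g h : GammaSL) (X : Matrix (Fin 2) (Fin 2) ℝ) :
    pairAct i j (g * h) X = pairAct i j g (pairAct i j h X) := by
  simp only [pairAct_apply, _root_.mul_inv_rev, map_mul, mul_assoc]

theorem pairAct_ne_zero {i j : Fin 3} (g : GammaSL) {X : Matrix (Fin 2) (Fin 2) ℝ} (h : X ≠ 0) :
    pairAct i j g X ≠ 0 := by
  intro h0
  apply h
  rw [← pairAct_one i j X, ← inv_mul_cancel g, pairAct_mul, h0, map_zero]

/-- The irreducible piece of the representation `pairAct i j`: all matrices if `i ≠ j`, those of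
trace zero if `i = j`. -/
def pairSpace (i j : Fin 3) : Submodule ℝ (Matrix (Fin 2) (Fin 2) ℝ) where
  carrier := {X | i = j → X.trace = 0}
  add_mem' hX hY h := by rw [trace_add, hX h, hY h, add_zero]
  zero_mem' _ := trace_zero _ _
  smul_mem' c X hX h := by rw [trace_smul, hX h, smul_zero]

theorem mem_pairSpace {i j : Fin 3} {X : Matrix (Fin 2) (Fin 2) ℝ} :
    X ∈ pairSpace i j ↔ (i = j → X.trace = 0) := Iff.rfl

theorem pairAct_mem_pairSpace {i j : Fin 3} (g : GammaSL) {X : Matrix (Fin 2) (Fin 2) ℝ}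
    (hX : X ∈ pairSpace i j) : pairAct i j g X ∈ pairSpace i j := by
  rintro rfl
  rw [pairAct_apply, trace_mul_comm, ← mul_assoc, mat_inv_mul, one_mul]
  exact hX rfl

theorem pairAct_mem_polyFun (i j : Fin 3) (X : Matrix (Fin 2) (Fin 2) ℝ) (a b : Fin 2) :
    (fun g => pairAct i j g X a b) ∈ polyFun := by
  simp only [pairAct_apply, mul_apply]
  exact sum_mem_polyFun _ fun _ _ => mul_mem_polyFun (sum_mem_polyFun _ fun _ _ =>
    mul_mem_polyFun (mat_mem_polyFun _ _ _) (const_mem_polyFun _)) (mat_inv_mem_polyFun _ _ _)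

/-- The functional `X ↦ φᵀ gᵢ X gⱼ⁻¹ w`. -/
noncomputable def pairFun (i j : Fin 3) (φ w : Fin 2 → ℝ) (g : GammaSL) :
    Matrix (Fin 2) (Fin 2) ℝ →ₗ[ℝ] ℝ where
  toFun X := φ ⬝ᵥ (pairAct i j g X *ᵥ w)
  map_add' X Y := by rw [map_add, add_mulVec, dotProduct_add]
  map_smul' c X := by rw [map_smul, smul_mulVec, dotProduct_smul]; rfl

theorem pairFun_apply (i j : Fin 3) (φ w : Fin 2 → ℝ) (g : GammaSL)
    (X : Matrix (Fin 2) (Fin 2) ℝ) : pairFun i j φ w g X = φ ⬝ᵥ (pairAct i j g X *ᵥ w) := rfl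

theorem pairFun_mem_polyFun (i j : Fin 3) (φ w : Fin 2 → ℝ) (X : Matrix (Fin 2) (Fin 2) ℝ) :
    (fun g => pairFun i j φ w g X) ∈ polyFun := by
  simp only [pairFun_apply, dotProduct, mulVec]
  exact sum_mem_polyFun _ fun _ _ => mul_mem_polyFun (const_mem_polyFun _)
    (sum_mem_polyFun _ fun _ _ =>
      mul_mem_polyFun (pairAct_mem_polyFun _ _ _ _ _) (const_mem_polyFun _))

theorem mat_incl_self (R : Type*) [CommRing R] (i : Fin 3) (u : SL2Z) :
    mat R i (incl i u) = Matrix.map (u : Matrix (Fin 2) (Fin 2) ℤ) (Int.castRingHom R) := by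
  ext a b
  rw [mat_apply, coord_incl_self]
  rfl

theorem mat_incl_of_ne (R : Type*) [CommRing R] {i j : Fin 3} (h : j ≠ i) (u : SL2Z) :
    mat R j (incl i u) = 1 := by
  ext a b
  rw [mat_apply, coord_incl_of_ne h]
  fin_cases a <;> fin_cases b <;> simp

theorem mat_incl_unip_true (R : Type*) [CommRing R] (i : Fin 3) (n : ℤ) :
    mat R i (incl i (unip true n)) = !![1, (n : R); 0, 1] := by
  rw [mat_incl_self]
  ext a b
  fin_cases a <;> fin_cases b <;> simp [unip]

theorem mat_incl_unip_false (R : Type*) [CommRing R] (i : Fin 3) (n : ℤ) :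
    mat R i (incl i (unip false n)) = !![1, 0; (n : R), 1] := by
  rw [mat_incl_self]
  ext a b
  fin_cases a <;> fin_cases b <;> simp [unip]

theorem exists_pairFun_ne_zero {i j : Fin 3} {φ w : Fin 2 → ℝ} (hφ : φ ≠ 0) (hw : w ≠ 0)
    {X : Matrix (Fin 2) (Fin 2) ℝ} (hX : X ∈ pairSpace i j) (hX0 : X ≠ 0) :
    ∃ g, pairFun i j φ w g X ≠ 0 := by
  by_contra! hcon
  let K : Submodule ℝ (Matrix (Fin 2) (Fin 2) ℝ) := ⨅ g, LinearMap.ker (pairFun i j φ w g)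
  have hK : ∀ Z, Z ∈ K ↔ ∀ g, pairFun i j φ w g Z = 0 := by simp [K]
  have hconj : ∀ g, ∀ Z ∈ K, pairAct i j g Z ∈ K := by
    intro g Z hZ
    rw [hK] at hZ ⊢
    intro h
    rw [pairFun_apply, ← pairAct_mul]
    exact hZ _
  have hone : ∀ Z ∈ K, φ ⬝ᵥ (Z *ᵥ w) = 0 := by
    intro Z hZ
    simpa [pairFun_apply, pairAct_one] using (hK Z).1 hZ 1
  have hXK : X ∈ K := (hK X).2 hcon
  have hφ' : φ 0 ≠ 0 ∨ φ 1 ≠ 0 := by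
    by_contra! h; exact hφ (by ext a; fin_cases a; exacts [h.1, h.2])
  have hw' : w 0 ≠ 0 ∨ w 1 ≠ 0 := by
    by_contra! h; exact hw (by ext a; fin_cases a; exacts [h.1, h.2])
  have hX' : X = !![X 0 0, X 0 1; X 1 0, X 1 1] := by
    ext a b; fin_cases a <;> fin_cases b <;> rfl
  by_cases hij : i = j
  · subst hij
    have h1 : ∀ n : ℤ, ∀ Z ∈ K, !![1, (n : ℝ); 0, 1] * Z * !![1, -(n : ℝ); 0, 1] ∈ K := by
      intro n Z hZ
      have := hconj (incl i (unip true n)) Z hZ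
      rw [pairAct_apply, ← map_inv, unip_inv, mat_incl_unip_true, mat_incl_unip_true] at this
      simpa using this
    have h2 : ∀ n : ℤ, ∀ Z ∈ K, !![1, 0; (n : ℝ), 1] * Z * !![1, 0; -(n : ℝ), 1] ∈ K := by
      intro n Z hZ
      have := hconj (incl i (unip false n)) Z hZ
      rw [pairAct_apply, ← map_inv, unip_inv, mat_incl_unip_false, mat_incl_unip_false] at this
      simpa using this
    have hE : ∀ a b c : ℝ, !![a, b; c, -a] ∈ K → c ≠ 0 → !![0, 1; 0, 0] ∈ K := by
      intro a b c h hc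
      have := K.smul_mem (-(2 * c)⁻¹) (K.sub_mem (K.add_mem (h1 1 _ h) (h1 (-1) _ h))
        (K.smul_mem 2 h))
      convert this using 1
      ext x y
      fin_cases x <;> fin_cases y <;> simp [mul_apply, Fin.sum_univ_two] <;> field_simp <;>
        ring_nf <;> simp
    have hF : ∀ a b c : ℝ, !![a, b; c, -a] ∈ K → b ≠ 0 → !![0, 0; 1, 0] ∈ K := by
      intro a b c h hc
      have := K.smul_mem (-(2 * b)⁻¹) (K.sub_mem (K.add_mem (h2 1 _ h) (h2 (-1) _ h))
        (K.smul_mem 2 h))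
      convert this using 1
      ext x y
      fin_cases x <;> fin_cases y <;> simp [mul_apply, Fin.sum_univ_two] <;> field_simp <;>
        ring_nf <;> simp
    have htr : X 1 1 = - X 0 0 := by
      have := hX rfl
      rw [trace_fin_two] at this
      linarith
    rw [hX', htr] at hXK
    have hEF : !![(0 : ℝ), 1; 0, 0] ∈ K ∧ !![(0 : ℝ), 0; 1, 0] ∈ K := by
      have hEtoF : !![(0 : ℝ), 1; 0, 0] ∈ K → !![(0 : ℝ), 0; 1, 0] ∈ K := fun h =>
        hF 0 1 0 (by simpa using h) one_ne_zero
      have hFtoE : !![(0 : ℝ), 0; 1, 0] ∈ K → !![(0 : ℝ), 1; 0, 0] ∈ K := fun h =>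
        hE 0 0 1 (by simpa using h) one_ne_zero
      by_cases hc : X 1 0 = 0
      · by_cases hb : X 0 1 = 0
        · have ha : X 0 0 ≠ 0 := by
            intro ha
            apply hX0
            rw [hX', htr, ha, hb, hc]
            ext x y; fin_cases x <;> fin_cases y <;> simp
          have : !![(0 : ℝ), 1; 0, 0] ∈ K := by
            have := K.smul_mem (-(2 * X 0 0)⁻¹) (K.sub_mem (h1 1 _ hXK) hXK)
            convert this using 1
            ext x y
            fin_cases x <;> fin_cases y <;> simp [mul_apply, Fin.sum_univ_two, hb, hc]
            field_simp; ring
          exact ⟨this, hEtoF this⟩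
        · have := hF _ _ _ hXK hb
          exact ⟨hFtoE this, this⟩
      · have := hE _ _ _ hXK hc
        exact ⟨this, hEtoF this⟩
    have e1 := hone _ hEF.1
    have e2 := hone _ hEF.2
    have e3 := hone _ (h1 1 _ hEF.2)
    simp [dotProduct, mulVec, Fin.sum_univ_two, mul_apply, vecMul] at e1 e2 e3
    rcases e1 with e | e <;> rcases e2 with f | f <;> simp [e, f] at hφ' hw' e3 <;> tauto
  · have h1 : ∀ n : ℤ, ∀ Z ∈ K, !![1, (n : ℝ); 0, 1] * Z ∈ K := by
      intro n Z hZ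
      have := hconj (incl i (unip true n)) Z hZ
      rw [pairAct_apply, ← map_inv, unip_inv, mat_incl_unip_true,
        mat_incl_of_ne _ (Ne.symm hij)] at this
      simpa using this
    have h2 : ∀ n : ℤ, ∀ Z ∈ K, !![1, 0; (n : ℝ), 1] * Z ∈ K := by
      intro n Z hZ
      have := hconj (incl i (unip false n)) Z hZ
      rw [pairAct_apply, ← map_inv, unip_inv, mat_incl_unip_false,
        mat_incl_of_ne _ (Ne.symm hij)] at this
      simpa using this
    have h3 : ∀ n : ℤ, ∀ Z ∈ K, Z * !![1, -(n : ℝ); 0, 1] ∈ K := by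
      intro n Z hZ
      have := hconj (incl j (unip true n)) Z hZ
      rw [pairAct_apply, ← map_inv, unip_inv, mat_incl_unip_true,
        mat_incl_of_ne _ hij] at this
      simpa using this
    have h4 : ∀ n : ℤ, ∀ Z ∈ K, Z * !![1, 0; -(n : ℝ), 1] ∈ K := by
      intro n Z hZ
      have := hconj (incl j (unip false n)) Z hZ
      rw [pairAct_apply, ← map_inv, unip_inv, mat_incl_unip_false,
        mat_incl_of_ne _ hij] at this
      simpa using this
    have g1 : ∀ Z ∈ K, !![0, 1; 0, 0] * Z ∈ K := by
      intro Z hZ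
      have := K.sub_mem (h1 1 _ hZ) hZ
      convert this using 1
      ext x y; fin_cases x <;> fin_cases y <;>
        simp [mul_apply, Fin.sum_univ_two, vecMul, dotProduct]
    have g2 : ∀ Z ∈ K, !![0, 0; 1, 0] * Z ∈ K := by
      intro Z hZ
      have := K.sub_mem (h2 1 _ hZ) hZ
      convert this using 1
      ext x y; fin_cases x <;> fin_cases y <;>
        simp [mul_apply, Fin.sum_univ_two, vecMul, dotProduct]
    have g3 : ∀ Z ∈ K, Z * !![0, 1; 0, 0] ∈ K := by
      intro Z hZ
      have := K.sub_mem (h3 (-1) _ hZ) hZ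
      convert this using 1
      ext x y; fin_cases x <;> fin_cases y <;>
        simp [mul_apply, Fin.sum_univ_two]
    have g4 : ∀ Z ∈ K, Z * !![0, 0; 1, 0] ∈ K := by
      intro Z hZ
      have := K.sub_mem (h4 (-1) _ hZ) hZ
      convert this using 1
      ext x y; fin_cases x <;> fin_cases y <;>
        simp [mul_apply, Fin.sum_univ_two]
    have hz : ∀ Z ∈ K, Z 0 0 = 0 := by
      intro Z hZ
      have a1 := hone _ (g1 _ (g2 _ (g4 _ (g3 _ hZ))))
      have a2 := hone _ (g1 _ (g2 _ (g3 _ hZ)))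
      have a3 := hone _ (g2 _ (g4 _ (g3 _ hZ)))
      have a4 := hone _ (g2 _ (g3 _ hZ))
      simp [dotProduct, mulVec, Fin.sum_univ_two, mul_apply, vecMul] at a1 a2 a3 a4
      tauto
    apply hX0
    have e1 := hz _ hXK
    have e2 := hz _ (g1 _ hXK)
    have e3 := hz _ (g4 _ hXK)
    have e4 := hz _ (g1 _ (g4 _ hXK))
    simp [mul_apply, Fin.sum_univ_two] at e2 e3 e4
    rw [hX', e1, e2, e3, e4]
    ext x y; fin_cases x <;> fin_cases y <;> simp

section EvenWords

variable {G : Type*} [Group G] {S : Set G}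

/-- The words of even length in a symmetric set `S` form a subgroup. -/
def evenWords (S : Set G) (hsym : S⁻¹ = S) : Subgroup G where
  carrier := {g | ∃ n, g ∈ S ^ (2 * n)}
  mul_mem' := by
    rintro a b ⟨n, hn⟩ ⟨m, hm⟩
    exact ⟨n + m, by rw [mul_add, pow_add]; exact Set.mul_mem_mul hn hm⟩
  one_mem' := ⟨0, by simp⟩
  inv_mem' := by
    rintro a ⟨n, hn⟩
    refine ⟨n, ?_⟩
    rw [← Set.mem_inv, ← inv_pow, hsym]
    exact hn

theorem mem_evenWords {hsym : S⁻¹ = S} {g : G} :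
    g ∈ evenWords S hsym ↔ ∃ n, g ∈ S ^ (2 * n) := Iff.rfl

theorem mul_mem_evenWords {hsym : S⁻¹ = S} {a b : G} (ha : a ∈ S) (hb : b ∈ S) :
    a * b ∈ evenWords S hsym := ⟨1, by rw [mul_one, pow_two]; exact Set.mul_mem_mul ha hb⟩

theorem pow_two_mul_subset (hsym : S⁻¹ = S) (hS : S.Nonempty) {n m : ℕ} (h : n ≤ m) :
    S ^ (2 * n) ⊆ S ^ (2 * m) := by
  obtain ⟨s, hs⟩ := hS
  have h1 : (1 : G) ∈ S ^ 2 := by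
    rw [pow_two, ← mul_inv_cancel s]
    exact Set.mul_mem_mul hs (by rw [← hsym]; exact Set.inv_mem_inv.2 hs)
  rw [pow_mul, pow_mul]
  exact Set.pow_subset_pow_right h1 h

theorem mem_evenWords_or (hsym : S⁻¹ = S) {s : G} (hs : s ∈ S) {g : G}
    (hg : g ∈ Subgroup.closure S) : g ∈ evenWords S hsym ∨ g * s ∈ evenWords S hsym := by
  have hinv : ∀ x ∈ S, x⁻¹ ∈ S := fun x hx => by rw [← hsym]; exact Set.inv_mem_inv.2 hx
  have key : ∀ x ∈ S, ∀ y, (y ∈ evenWords S hsym ∨ y * s ∈ evenWords S hsym) →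
      (y * x ∈ evenWords S hsym ∨ y * x * s ∈ evenWords S hsym) := by
    rintro x hx y (h | h)
    · right
      rw [mul_assoc]
      exact mul_mem h (mul_mem_evenWords hx hs)
    · left
      have := mul_mem h (mul_mem_evenWords (hsym := hsym) (hinv s hs) hx)
      simpa [mul_assoc] using this
  induction hg using Subgroup.closure_induction_right with
  | one => exact Or.inl (one_mem _)
  | mul_right y hy x hx ih => exact key x hx y ih
  | mul_inv_cancel y hy x hx ih => exact key _ (hinv x hx) y ih

theorem conj_mem_evenWords (hsym : S⁻¹ = S) (hS : S.Nonempty) {b h : G}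
    (hb : b ∈ Subgroup.closure S) (hh : h ∈ evenWords S hsym) :
    b⁻¹ * h * b ∈ evenWords S hsym := by
  obtain ⟨s, hs⟩ := hS
  have hinv : ∀ x ∈ S, x⁻¹ ∈ S := fun x hx => by rw [← hsym]; exact Set.inv_mem_inv.2 hx
  rcases mem_evenWords_or hsym hs hb with h' | h'
  · exact mul_mem (mul_mem (inv_mem h') hh) h'
  · obtain ⟨n, hn⟩ := mul_mem (mul_mem (inv_mem h') hh) h'
    refine ⟨n + 1, ?_⟩
    have := Set.mul_mem_mul (Set.mul_mem_mul hs hn) (hinv s hs)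
    rw [← pow_succ', ← pow_succ] at this
    have heq : b⁻¹ * h * b = s * ((b * s)⁻¹ * h * (b * s)) * s⁻¹ := by group
    rwa [heq]

end EvenWords

theorem exists_forall_abs_gt {H : Subgroup GammaSL} (hH : ZariskiDense H) (i : Fin 3)
    (s : GammaSL) (C : ℕ) :
    ∃ h ∈ H, (C : ℝ) < |mat ℝ i h 0 0| ∧ (C : ℝ) < |mat ℝ i (h * s) 0 0| := by
  let f : GammaSL → ℝ := fun g => ∏ c ∈ Finset.Icc (-(C : ℤ)) C, (mat ℝ i g 0 0 - c)
  have hf : f ∈ polyFun := prod_mem_polyFun _ fun c _ =>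
    polyFun.sub_mem (mat_mem_polyFun i 0 0) (const_mem_polyFun c)
  have hne : ∀ g : GammaSL, f g ≠ 0 ↔ (C : ℝ) < |mat ℝ i g 0 0| := by
    intro g
    rw [Finset.prod_ne_zero_iff, mat_apply]
    constructor
    · intro h
      by_contra! hle
      have hle' : |coord i g 0 0| ≤ (C : ℤ) := by exact_mod_cast hle
      exact h _ (Finset.mem_Icc.2 (abs_le.1 hle')) (sub_self _)
    · intro h c hc h0
      have h1 : |coord i g 0 0| ≤ (C : ℤ) := by
        have : coord i g 0 0 = c := by exact_mod_cast sub_eq_zero.1 h0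
        rw [this]
        exact abs_le.2 (Finset.mem_Icc.1 hc)
      have : |((coord i g 0 0 : ℤ) : ℝ)| ≤ C := by exact_mod_cast h1
      linarith
  have hex : ∃ g, f g ≠ 0 := by
    refine ⟨incl i (unip true C) * incl i (unip false 1), (hne _).2 ?_⟩
    rw [map_mul, mat_incl_unip_true, mat_incl_unip_false]
    simp only [mul_apply, Fin.sum_univ_two]
    simp
    rw [abs_of_nonneg (by positivity)]
    linarith
  obtain ⟨g, hg⟩ := exists_ne_zero_and_ne_zero hf (polyFun_mul_right hf s) hex
    (by obtain ⟨g, hg⟩ := hex; exact ⟨g * s⁻¹, by simpa using hg⟩)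
  obtain ⟨h, hh, h0⟩ := exists_mem_ne_zero_of_zariskiDense hH
    (mul_mem_polyFun hf (polyFun_mul_right hf s)) ⟨g, mul_ne_zero hg.1 hg.2⟩
  exact ⟨h, hh, (hne _).1 (left_ne_zero_of_mul h0), (hne _).1 (right_ne_zero_of_mul h0)⟩

theorem adjugate_ne_zero {P : Matrix (Fin 2) (Fin 2) ℝ} (hP : P ≠ 0) : P.adjugate ≠ 0 := by
  intro h
  apply hP
  rw [adjugate_fin_two] at h
  have h0 := congrFun (congrFun h 0) 0
  have h1 := congrFun (congrFun h 0) 1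
  have h2 := congrFun (congrFun h 1) 0
  have h3 := congrFun (congrFun h 1) 1
  simp at h0 h1 h2 h3
  ext a b
  fin_cases a <;> fin_cases b <;> simp [*]

section NormedMatrix

attribute [local instance] Matrix.normedAddCommGroup Matrix.normedSpace

theorem one_le_norm_mat (i : Fin 3) (g : GammaSL) : 1 ≤ ‖mat ℝ i g‖ := by
  by_contra! hlt
  have h0 : ∀ a b, coord i g a b = 0 := by
    intro a b
    have h1 := (norm_entry_le_entrywise_sup_norm (mat ℝ i g) (i := a) (j := b)).trans_lt hlt
    rw [mat_apply, Real.norm_eq_abs] at h1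
    have h2 : |coord i g a b| < 1 := by exact_mod_cast h1
    exact Int.abs_lt_one_iff.1 h2
  have := (coord i g).det_coe
  rw [det_fin_two] at this
  have e1 : (coord i g : Matrix (Fin 2) (Fin 2) ℤ) 0 0 = 0 := h0 0 0
  have e2 : (coord i g : Matrix (Fin 2) (Fin 2) ℤ) 0 1 = 0 := h0 0 1
  rw [e1, e2] at this
  simp at this

open Filter Topology in
theorem exists_tendsto_normalized {S : Set GammaSL} (hsym : S⁻¹ = S) (hS : S.Nonempty)
    (hH : ZariskiDense (Subgroup.closure S)) (i j : Fin 3) :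
    ∃ (h : ℕ → GammaSL) (a c : ℕ → ℝ) (P Q : Matrix (Fin 2) (Fin 2) ℝ),
      (∀ k, h k ∈ evenWords S hsym) ∧ P ≠ 0 ∧ Q ≠ 0 ∧ Tendsto (fun k => a k * c k) atTop atTop ∧
      Tendsto (fun k => (a k)⁻¹ • mat ℝ i (h k)) atTop (𝓝 P) ∧
      Tendsto (fun k => (c k)⁻¹ • mat ℝ j (h k)) atTop (𝓝 Q) := by
  obtain ⟨s, hs⟩ := hS
  have hex : ∀ k : ℕ, ∃ h ∈ evenWords S hsym, (k : ℝ) ≤ ‖mat ℝ i h‖ := by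
    intro k
    obtain ⟨h, hh, h1, h2⟩ := exists_forall_abs_gt hH i s k
    have hle : ∀ g, |mat ℝ i g 0 0| ≤ ‖mat ℝ i g‖ := fun g => by
      rw [← Real.norm_eq_abs]; exact norm_entry_le_entrywise_sup_norm _
    rcases mem_evenWords_or hsym hs hh with h' | h'
    · exact ⟨h, h', h1.le.trans (hle _)⟩
    · exact ⟨h * s, h', h2.le.trans (hle _)⟩
  choose h hE hk using hex
  have hpos : ∀ (i : Fin 3) k, 0 < ‖mat ℝ i (h k)‖ :=
    fun i k => zero_lt_one.trans_le (one_le_norm_mat _ _)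
  have hsph : ∀ k, ((‖mat ℝ i (h k)‖⁻¹ • mat ℝ i (h k)), (‖mat ℝ j (h k)‖⁻¹ • mat ℝ j (h k))) ∈
      Metric.sphere (0 : Matrix (Fin 2) (Fin 2) ℝ) 1 ×ˢ Metric.sphere 0 1 := by
    intro k
    simp [norm_smul, (hpos _ k).ne']
  obtain ⟨⟨P, Q⟩, hPQ, θ, hθ, hlim⟩ :=
    ((isCompact_sphere _ _).prod (isCompact_sphere _ _)).tendsto_subseq hsph
  refine ⟨h ∘ θ, fun k => ‖mat ℝ i (h (θ k))‖, fun k => ‖mat ℝ j (h (θ k))‖, P, Q,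
    fun k => hE _, ?_, ?_, ?_, ?_, ?_⟩
  · rintro rfl
    simpa using hPQ.1
  · rintro rfl
    simpa using hPQ.2
  · refine tendsto_atTop_mono (fun k => ?_) (tendsto_natCast_atTop_atTop (R := ℝ))
    calc (k : ℝ) ≤ (θ k : ℝ) := by exact_mod_cast hθ.le_apply
      _ ≤ ‖mat ℝ i (h (θ k))‖ := hk _
      _ ≤ _ := le_mul_of_one_le_right (hpos _ _).le (one_le_norm_mat _ _)
  · exact (continuous_fst.tendsto _).comp hlim
  · exact (continuous_snd.tendsto _).comp hlim

open Filter Topology in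
/-- The conjugates by general elements of a sequence with nonzero rescaled limit expand all but
three of the directions. -/
theorem eventually_card_pairAct_le {i j : Fin 3} {h : ℕ → GammaSL} {s : ℕ → ℝ}
    {p q : ℕ → Matrix (Fin 2) (Fin 2) ℝ} {P Q : Matrix (Fin 2) (Fin 2) ℝ}
    (hs : Tendsto s atTop atTop) (hp : Tendsto p atTop (𝓝 P)) (hq : Tendsto q atTop (𝓝 Q))
    (hpq : ∀ k X, (s k)⁻¹ • pairAct i j (h k) X = p k * X * q k) {a b : Fin 2}
    {t : Fin 12 → GammaSL}
    (ht : ∀ X ∈ pairSpace i j, X ≠ 0 → ∀ J : Finset (Fin 12),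
      (∀ r ∈ J, pairFun i j (P a) (fun x => Q x b) (t r) X = 0) → J.card ≤ 3) :
    ∀ᶠ k in atTop, ∀ X ∈ pairSpace i j, X ≠ 0 → ∀ J : Finset (Fin 12),
      (∀ r ∈ J, ‖pairAct i j ((t r)⁻¹ * h k * t r) X‖ ≤ ‖X‖) → J.card ≤ 3 := by
  refine eventually_card_filter_norm_le (pairSpace i j) (m := 3)
    (T := fun k r X => pairAct i j ((t r)⁻¹ * h k * t r) X)
    (L := fun r X => pairAct i j (t r)⁻¹ (P * pairAct i j (t r) X * Q)) hs
    (fun k r c X => map_smul _ _ _) (fun r X => ?_) (fun X hX hX0 J hJ => ht X hX hX0 J ?_)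
  · have hcont : ∀ g, Continuous (pairAct i j g) := fun g =>
      LinearMap.continuous_of_finiteDimensional _
    have h1 : Tendsto (fun z : ℕ × Matrix (Fin 2) (Fin 2) ℝ => p z.1 * pairAct i j (t r) z.2 * q z.1)
        (atTop ×ˢ 𝓝 X) (𝓝 (P * pairAct i j (t r) X * Q)) :=
      ((hp.comp tendsto_fst).mul (((hcont _).tendsto X).comp tendsto_snd)).mul
        (hq.comp tendsto_fst)
    refine (((hcont (t r)⁻¹).tendsto _).comp h1).congr fun z => ?_
    simp only [Function.comp]
    rw [← hpq, map_smul, pairAct_mul, pairAct_mul]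
  · intro r hr
    have h0 : P * pairAct i j (t r) X * Q = 0 := by
      by_contra hne
      exact pairAct_ne_zero _ hne (hJ r hr)
    rw [pairFun_apply]
    have := congrFun (congrFun h0 a) b
    rw [mul_assoc, mul_apply] at this
    simpa [dotProduct, mulVec, mul_apply] using this

theorem exists_row_ne_zero {P : Matrix (Fin 2) (Fin 2) ℝ} (hP : P ≠ 0) : ∃ a, P a ≠ 0 := by
  by_contra! h
  exact hP (funext h)

theorem exists_col_ne_zero {P : Matrix (Fin 2) (Fin 2) ℝ} (hP : P ≠ 0) :
    ∃ b, (fun x => P x b) ≠ 0 := by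
  by_contra! h
  exact hP (by ext a b; exact congrFun (h b) a)

/-- The action of `Γ` on matrices through `pairAct`. -/
noncomputable abbrev pairMulAction (i j : Fin 3) :
    MulAction GammaSL (Matrix (Fin 2) (Fin 2) ℝ) where
  smul g X := pairAct i j g X
  one_smul := pairAct_one i j
  mul_smul := pairAct_mul i j

open Filter Topology in
theorem exists_expanding {S : Set GammaSL} (hsym : S⁻¹ = S) (hS : S.Nonempty)
    (hH : ZariskiDense (Subgroup.closure S)) (i j : Fin 3) :
    ∃ t : Fin 12 → GammaSL, (∀ r, t r ∈ evenWords S hsym) ∧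
      (∀ X ∈ pairSpace i j, X ≠ 0 → ∀ J : Finset (Fin 12),
        (∀ r ∈ J, ‖pairAct i j (t r) X‖ ≤ ‖X‖) → J.card ≤ 3) ∧
      (∀ X ∈ pairSpace i j, X ≠ 0 → ∀ J : Finset (Fin 12),
        (∀ r ∈ J, ‖pairAct i j (t r)⁻¹ X‖ ≤ ‖X‖) → J.card ≤ 3) := by
  obtain ⟨h, a, c, P, Q, hE, hP, hQ, hac, hhP, hhQ⟩ := exists_tendsto_normalized hsym hS hH i j
  have hadj : ∀ (x : ℝ) (A : Matrix (Fin 2) (Fin 2) ℝ), (x • A).adjugate = x • A.adjugate := by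
    intro x A
    rw [adjugate_smul]
    simp
  have hcadj : Continuous (adjugate : Matrix (Fin 2) (Fin 2) ℝ → _) :=
    Continuous.matrix_adjugate continuous_id
  have hhP' := (hcadj.tendsto P).comp hhP
  have hhQ' := (hcadj.tendsto Q).comp hhQ
  obtain ⟨a1, ha1⟩ := exists_row_ne_zero hP
  obtain ⟨a2, ha2⟩ := exists_row_ne_zero (adjugate_ne_zero hP)
  obtain ⟨b1, hb1⟩ := exists_col_ne_zero (adjugate_ne_zero hQ)
  obtain ⟨b2, hb2⟩ := exists_col_ne_zero hQ
  let φ : Bool → Fin 2 → ℝ := fun e => bif e then P a1 else P.adjugate a2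
  let w : Bool → Fin 2 → ℝ := fun e => bif e then (fun x => Q.adjugate x b1) else (fun x => Q x b2)
  have hφ : ∀ e, φ e ≠ 0 := by rintro (_ | _) <;> assumption
  have hw : ∀ e, w e ≠ 0 := by rintro (_ | _) <;> assumption
  obtain ⟨b, hbH, hb⟩ := exists_card_filter_eq_zero_le hH (pairSpace i j)
    (fun e g => pairFun i j (φ e) (w e) g) (fun e X => pairFun_mem_polyFun _ _ _ _ _)
    (fun e X hX hX0 => exists_pairFun_ne_zero (hφ e) (hw e) hX hX0) 12
  have hdim : Module.finrank ℝ (pairSpace i j) ≤ 4 := by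
    refine (Submodule.finrank_le _).trans_eq ?_
    rw [Module.finrank_matrix]
    simp
  have hb' : ∀ e, ∀ X ∈ pairSpace i j, X ≠ 0 → ∀ J : Finset (Fin 12),
      (∀ r ∈ J, pairFun i j (φ e) (w e) (b r) X = 0) → J.card ≤ 3 := by
    intro e X hX hX0 J hJ
    have := hb e X hX hX0 J hJ
    omega
  have e1 := eventually_card_pairAct_le (i := i) (j := j) (h := h) (a := a1) (b := b1) (t := b)
    hac hhP hhQ' (fun k X => by
      simp only [Function.comp, hadj, pairAct_apply, mat_inv, smul_mul_assoc, mul_smul_comm,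
        smul_smul, mul_inv]
      rw [mul_comm]) (hb' true)
  have e2 := eventually_card_pairAct_le (i := i) (j := j) (h := fun k => (h k)⁻¹)
    (a := a2) (b := b2) (t := b) hac hhP' hhQ (fun k X => by
      simp only [Function.comp, hadj, pairAct_apply, inv_inv, mat_inv, smul_mul_assoc,
        mul_smul_comm, smul_smul, mul_inv]
      rw [mul_comm]) (hb' false)
  obtain ⟨k, hk1, hk2⟩ := (e1.and e2).exists
  refine ⟨fun r => (b r)⁻¹ * h k * b r, fun r => conj_mem_evenWords hsym hS (hbH r) (hE k), hk1, ?_⟩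
  intro X hX hX0 J hJ
  refine hk2 X hX hX0 J fun r hr => ?_
  have := hJ r hr
  rwa [show ((b r)⁻¹ * h k * b r)⁻¹ = (b r)⁻¹ * (h k)⁻¹ * b r by group] at this

theorem exists_expDecay_hitProb {S : Finset GammaSL} (hsym : (S : Set GammaSL)⁻¹ = S)
    (hS : S.Nonempty) (hH : ZariskiDense (Subgroup.closure (S : Set GammaSL))) (i j : Fin 3) :
    ∃ b, ExpDecay b ∧ ∀ X ∈ pairSpace i j, X ≠ 0 → ∀ l,
      @hitProb _ _ _ (pairMulAction i j) S (l + l) X X ≤ b l := by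
  let := pairMulAction i j
  obtain ⟨t, ht, h1, h2⟩ := exists_expanding hsym (by simpa using hS) hH i j
  have hsym' : ∀ s, s ∈ S → s⁻¹ ∈ S := by
    intro s hs
    have : s⁻¹ ∈ (S : Set GammaSL)⁻¹ := Set.inv_mem_inv.2 hs
    rw [hsym] at this
    exact this
  choose n hn using fun r => mem_evenWords.1 (ht r)
  let m := (∑ r, n r) + 1
  have hm : ∀ r, n r ≤ m := fun r => by
    have := Finset.single_le_sum (f := n) (fun _ _ => Nat.zero_le _) (Finset.mem_univ r)
    omega
  obtain ⟨b, hb, hle⟩ := hitProb_expDecay (m := m) hS hsym' (by omega) t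
    (fun r => pow_two_mul_subset hsym (by simpa using hS) (hm r) (hn r))
    {X | X ∈ pairSpace i j ∧ X ≠ 0}
    (fun g X hX => ⟨pairAct_mem_pairSpace g hX.1, pairAct_ne_zero g hX.2⟩) (fun X => ‖X‖)
    (fun X hX => h1 X hX.1 hX.2 _ fun r hr => (Finset.mem_filter.1 hr).2)
    (fun X hX => h2 X hX.1 hX.2 _ fun r hr => (Finset.mem_filter.1 hr).2)
  exact ⟨b, hb, fun X hX hX0 l => hle X ⟨hX, hX0⟩ l⟩

open Classical in
/-- The probability that the walk fixes a nonzero matrix up to sign decays uniformly. -/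
theorem exists_expDecay_eq_or_neg {S : Finset GammaSL} (hsym : (S : Set GammaSL)⁻¹ = S)
    (hS : S.Nonempty) (hH : ZariskiDense (Subgroup.closure (S : Set GammaSL))) (i j : Fin 3) :
    ∃ b, ExpDecay b ∧ ∀ X ∈ pairSpace i j, X ≠ 0 → ∀ l,
      walkE S (l + l) (fun g => if pairAct i j g X = X ∨ pairAct i j g X = -X then 1 else 0) ≤
        b l := by
  obtain ⟨b, hb, h⟩ := exists_expDecay_hitProb hsym hS hH i j
  let := pairMulAction i j
  have hsym' : ∀ s, s ∈ S → s⁻¹ ∈ S := by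
    intro s hs
    have : s⁻¹ ∈ (S : Set GammaSL)⁻¹ := Set.inv_mem_inv.2 hs
    rw [hsym] at this
    exact this
  refine ⟨_, (hb.add (hb.add hb)), fun X hX hX0 l => ?_⟩
  have h1 := h X hX hX0 l
  have h2 := h (-X) (neg_mem hX) (neg_ne_zero.2 hX0) l
  have h3 := hitProb_le hS hsym' l X (-X)
  refine (walkE_mono hS _ (F' := fun g => (if g • X = X then 1 else 0) +
    (if g • X = -X then (1 : ℝ) else 0)) fun g => ?_).trans ?_
  · change (if g • X = X ∨ g • X = -X then (1 : ℝ) else 0) ≤ _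
    split_ifs <;> simp_all
  · rw [walkE_add_fun hS]
    refine le_of_eq_of_le (b := hitProb S (l + l) X X + hitProb S (l + l) X (-X))
      (by unfold hitProb; congr!) ?_
    change hitProb S (l + l) X X ≤ _ at h1
    change hitProb S (l + l) (-X) (-X) ≤ _ at h2
    linarith

end NormedMatrix

theorem exists_eq_intCast_of_forall_pow_mul {r : ℚ} {m : ℚ} (hm : m ≠ 0)
    (h : ∀ n : ℕ, ∃ z : ℤ, r ^ n * m = z) : ∃ z : ℤ, r = z := by
  obtain ⟨m', hm'⟩ := h 0
  rw [pow_zero, one_mul] at hm'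
  subst hm'
  have hm0 : m' ≠ 0 := by exact_mod_cast hm
  have hdvd : ∀ n : ℕ, (r.den : ℤ) ^ n ∣ m' := by
    intro n
    obtain ⟨z, hz⟩ := h n
    have hden : (r.den : ℚ) ≠ 0 := by exact_mod_cast r.den_nz
    have h1 : r.num ^ n * m' = z * (r.den : ℤ) ^ n := by
      have h2 : (r.num : ℚ) ^ n * m' = z * (r.den : ℚ) ^ n := by
        rw [← hz]
        nth_rw 2 [← Rat.num_div_den r]
        rw [div_pow]
        field_simp
      exact_mod_cast h2
    have hcop : IsCoprime ((r.den : ℤ) ^ n) (r.num ^ n) :=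
      IsCoprime.pow (Int.isCoprime_iff_gcd_eq_one.2 (by
        rw [Int.gcd_comm]; exact r.reduced))
    exact hcop.dvd_of_dvd_mul_left ⟨z, by rw [h1, mul_comm]⟩
  have hden1 : r.den = 1 := by
    by_contra hne
    have h2 : 2 ≤ r.den := by have := r.den_pos; omega
    have h3 := Int.natAbs_le_of_dvd_ne_zero (hdvd m'.natAbs) hm0
    rw [Int.natAbs_pow, Int.natAbs_natCast] at h3
    have h4 : m'.natAbs < r.den ^ m'.natAbs := Nat.lt_pow_self h2
    omega
  exact ⟨r.num, ((Rat.den_eq_one_iff r).1 hden1).symm⟩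

theorem exists_nat_mul_eq_intCast (y : Matrix (Fin 2) (Fin 2) ℚ) :
    ∃ d : ℚ, d ≠ 0 ∧ ∃ Y : Matrix (Fin 2) (Fin 2) ℤ, d • y = Y.map (Int.castRingHom ℚ) := by
  obtain ⟨d, hd⟩ := IsLocalization.exist_integer_multiples_of_finset (nonZeroDivisors ℤ)
    ((Finset.univ : Finset (Fin 2 × Fin 2)).image fun p => y p.1 p.2)
  have hd' : ∀ a b, ∃ z : ℤ, (z : ℚ) = ((d : ℤ) : ℚ) * y a b := by
    intro a b
    obtain ⟨z, hz⟩ := hd (y a b) (Finset.mem_image.2 ⟨(a, b), Finset.mem_univ _, rfl⟩)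
    refine ⟨z, ?_⟩
    rw [← zsmul_eq_mul]
    exact hz
  choose Y hY using hd'
  refine ⟨((d : ℤ) : ℚ), by exact_mod_cast nonZeroDivisors.ne_zero d.2, of Y, ?_⟩
  ext a b
  simp [hY]

theorem mat_rat_eq_map (i : Fin 3) (g : GammaSL) :
    mat ℚ i g = (mat ℤ i g).map (Int.castRingHom ℚ) := by
  ext a b
  simp [mat_apply]

theorem exists_eq_intCast_of_conj {i : Fin 3} {g : GammaSL} {y : Matrix (Fin 2) (Fin 2) ℚ}
    (hy : y ≠ 0) {r : ℚ} (h : mat ℚ i g * y * mat ℚ i g⁻¹ = r • y) : ∃ z : ℤ, r = z := by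
  obtain ⟨d, hd, Y, hY⟩ := exists_nat_mul_eq_intCast y
  have hpow : ∀ n : ℕ, mat ℚ i (g ^ n) * y * mat ℚ i (g ^ n)⁻¹ = r ^ n • y := by
    intro n
    induction n with
    | zero => simp
    | succ n ih =>
      rw [pow_succ', _root_.mul_inv_rev, map_mul, map_mul]
      calc _ = mat ℚ i g * (mat ℚ i (g ^ n) * y * mat ℚ i (g ^ n)⁻¹) * mat ℚ i g⁻¹ := by
            simp only [mul_assoc]
        _ = _ := by
          rw [ih, mul_smul_comm, smul_mul_assoc, h, smul_smul, pow_succ]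
  have hab : ∃ a b, y a b ≠ 0 := by
    by_contra! hcon
    exact hy (by ext a b; exact hcon a b)
  obtain ⟨a, b, hab⟩ := hab
  refine exists_eq_intCast_of_forall_pow_mul (mul_ne_zero hd hab) fun n => ?_
  refine ⟨(mat ℤ i (g ^ n) * Y * mat ℤ i (g ^ n)⁻¹) a b, ?_⟩
  have h1 : r ^ n • (d • y) = (mat ℤ i (g ^ n) * Y * mat ℤ i (g ^ n)⁻¹).map (Int.castRingHom ℚ) := by
    rw [Matrix.map_mul, Matrix.map_mul, ← mat_rat_eq_map, ← mat_rat_eq_map, ← hY, smul_comm,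
      ← hpow, mul_smul_comm, smul_mul_assoc]
  exact congrFun (congrFun h1 a) b

theorem eq_one_or_neg_one_of_conj {i : Fin 3} {g : GammaSL} {y : Matrix (Fin 2) (Fin 2) ℚ}
    (hy : y ≠ 0) {r : ℚ} (h : mat ℚ i g * y * mat ℚ i g⁻¹ = r • y) : r = 1 ∨ r = -1 := by
  have hr : r ≠ 0 := by
    rintro rfl
    apply hy
    calc y = mat ℚ i g⁻¹ * (mat ℚ i g * y * mat ℚ i g⁻¹) * mat ℚ i g := by
          simp only [mul_assoc, mat_inv_mul, mul_one]
          rw [← mul_assoc, mat_inv_mul, one_mul]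
      _ = 0 := by rw [h]; simp
  have h' : mat ℚ i g⁻¹ * y * mat ℚ i (g⁻¹)⁻¹ = r⁻¹ • y := by
    rw [eq_inv_smul_iff₀ hr, ← smul_mul_assoc, ← mul_smul_comm, ← h, inv_inv]
    simp only [mul_assoc, mat_inv_mul, mul_one]
    rw [← mul_assoc, mat_inv_mul, one_mul]
  obtain ⟨z, hz⟩ := exists_eq_intCast_of_conj hy h
  obtain ⟨z', hz'⟩ := exists_eq_intCast_of_conj hy h'
  have h1 : z * z' = 1 := by
    have : (z : ℚ) * z' = 1 := by rw [← hz, ← hz', mul_inv_cancel₀ hr]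
    exact_mod_cast this
  rcases Int.isUnit_iff.1 (IsUnit.of_mul_eq_one _ h1) with h | h
  · left; rw [hz, h]; simp
  · right; rw [hz, h]; simp

/-- Trace-zero matrices orthogonal to two noncommuting matrices are proportional. -/
theorem exists_eq_smul_of_trace_mul_eq_zero {a b y y' : Matrix (Fin 2) (Fin 2) ℚ}
    (hab : a * b ≠ b * a) (hy : y ≠ 0) (h0 : y.trace = 0) (ha : (y * a).trace = 0)
    (hb : (y * b).trace = 0) (h0' : y'.trace = 0) (ha' : (y' * a).trace = 0)
    (hb' : (y' * b).trace = 0) : ∃ r : ℚ, y' = r • y := by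
  simp only [trace_fin_two, mul_apply, Fin.sum_univ_two] at h0 ha hb h0' ha' hb'
  have e : y 1 1 = - y 0 0 := by linarith
  have e' : y' 1 1 = - y' 0 0 := by linarith
  rw [e] at ha hb
  rw [e'] at ha' hb'
  set p := y 0 0
  set q := y 0 1
  set r := y 1 0
  set p' := y' 0 0
  set q' := y' 0 1
  set r' := y' 1 0
  set w1 := a 1 0 * b 0 1 - a 0 1 * b 1 0 with hw1
  set w2 := a 0 1 * (b 0 0 - b 1 1) - (a 0 0 - a 1 1) * b 0 1 with hw2
  set w3 := (a 0 0 - a 1 1) * b 1 0 - a 1 0 * (b 0 0 - b 1 1) with hw3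
  have hw : w1 ≠ 0 ∨ w2 ≠ 0 ∨ w3 ≠ 0 := by
    by_contra! hcon
    obtain ⟨c1, c2, c3⟩ := hcon
    apply hab
    ext x z
    fin_cases x <;> fin_cases z <;> simp [mul_apply, Fin.sum_univ_two] <;> linarith
  have t1 : p * w2 = q * w1 := by rw [hw1, hw2]; linear_combination a 0 1 * hb - b 0 1 * ha
  have t2 : q * w3 = r * w2 := by
    rw [hw2, hw3]; linear_combination (a 0 0 - a 1 1) * hb - (b 0 0 - b 1 1) * ha
  have t3 : r * w1 = p * w3 := by rw [hw1, hw3]; linear_combination a 1 0 * hb - b 1 0 * ha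
  have t1' : p' * w2 = q' * w1 := by rw [hw1, hw2]; linear_combination a 0 1 * hb' - b 0 1 * ha'
  have t2' : q' * w3 = r' * w2 := by
    rw [hw2, hw3]; linear_combination (a 0 0 - a 1 1) * hb' - (b 0 0 - b 1 1) * ha'
  have t3' : r' * w1 = p' * w3 := by rw [hw1, hw3]; linear_combination a 1 0 * hb' - b 1 0 * ha'
  have hfin : ∀ c : ℚ, p' = c * p → q' = c * q → r' = c * r → ∃ r : ℚ, y' = r • y := by
    intro c h1 h2 h3
    refine ⟨c, ?_⟩
    ext x z
    fin_cases x <;> fin_cases z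
    · exact h1
    · exact h2
    · exact h3
    · change y' 1 1 = c * y 1 1
      rw [e, e', h1, mul_neg]
  have hyne : ¬ (p = 0 ∧ q = 0 ∧ r = 0) := by
    rintro ⟨h1, h2, h3⟩
    apply hy
    ext x z
    fin_cases x <;> fin_cases z
    · exact h1
    · exact h2
    · exact h3
    · change y 1 1 = 0
      rw [e, h1, neg_zero]
  have hz : ∀ {u v w x : ℚ}, w ≠ 0 → u * v = x * w → u = 0 → x = 0 := by
    intro u v w x hw h hu
    rw [hu, zero_mul] at h
    exact (mul_eq_zero.1 h.symm).resolve_right hw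
  have hc : ∀ {u u' v w x x' : ℚ}, w ≠ 0 → u ≠ 0 → u * v = x * w → u' * v = x' * w →
      x' = u' / u * x := by
    intro u u' v w x x' hw hu h h'
    field_simp
    apply mul_right_cancel₀ hw
    linear_combination u' * h - u * h'
  rcases hw with hw | hw | hw
  · have hp : p ≠ 0 := fun hp => hyne ⟨hp, hz hw t1 hp, hz hw t3.symm hp⟩
    exact hfin (p' / p) (by field_simp) (hc hw hp t1 t1') (hc hw hp t3.symm t3'.symm)
  · have hq : q ≠ 0 := fun hq => hyne ⟨hz hw t1.symm hq, hq, hz hw t2 hq⟩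
    exact hfin (q' / q) (hc hw hq t1.symm t1'.symm) (by field_simp) (hc hw hq t2 t2')
  · have hr : r ≠ 0 := fun hr => hyne ⟨hz hw t3 hr, hz hw t2.symm hr, hr⟩
    exact hfin (r' / r) (hc hw hr t3 t3') (hc hw hr t2.symm t2'.symm) (by field_simp)

/-- A subgroup of the `i`-th factor that is contained in a hyperplane of the space of matrices
fixes, up to sign, a nonzero matrix of trace zero. -/
theorem exists_conj_eq_or_neg_of_trace_mul_eq_zero {K : Subgroup GammaSL} {i : Fin 3}
    {y : Matrix (Fin 2) (Fin 2) ℚ} (hy : y ≠ 0) (h : ∀ k ∈ K, (y * mat ℚ i k).trace = 0) :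
    ∃ X : Matrix (Fin 2) (Fin 2) ℚ, X ≠ 0 ∧ X.trace = 0 ∧
      ∀ k ∈ K, mat ℚ i k * X * mat ℚ i k⁻¹ = X ∨ mat ℚ i k * X * mat ℚ i k⁻¹ = -X := by
  by_cases hcomm : ∀ k ∈ K, ∀ k' ∈ K, mat ℚ i k * mat ℚ i k' = mat ℚ i k' * mat ℚ i k
  · by_cases hsc : ∀ k ∈ K, ∃ c : ℚ, mat ℚ i k = c • 1
    · refine ⟨single 0 1 1, fun h0 => ?_, by simp [trace_fin_two, Matrix.single], fun k hk => ?_⟩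
      · simpa using congrFun (congrFun h0 0) 1
      · left
        obtain ⟨c, hc⟩ := hsc k hk
        have h1 := mat_mul_inv (R := ℚ) i k
        rw [hc, smul_mul_assoc, one_mul] at h1 ⊢
        rw [smul_mul_assoc, ← mul_smul_comm, h1, mul_one]
    · push Not at hsc
      obtain ⟨k₀, hk₀, hne⟩ := hsc
      refine ⟨mat ℚ i k₀ - ((mat ℚ i k₀).trace / 2) • 1, fun h0 => hne _ (sub_eq_zero.1 h0), ?_,
        fun k hk => ?_⟩
      · simp [trace_sub, trace_smul]
      · left
        rw [mul_sub, sub_mul, hcomm k hk k₀ hk₀, mul_assoc, mat_mul_inv, mul_one, mul_smul_comm,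
          mul_one, smul_mul_assoc, mat_mul_inv]
  · push Not at hcomm
    obtain ⟨a, ha, b, hb, hab⟩ := hcomm
    have h0 : y.trace = 0 := by simpa using h 1 K.one_mem
    refine ⟨y, hy, h0, fun k hk => ?_⟩
    have hconj : ∀ k' ∈ K, (mat ℚ i k * y * mat ℚ i k⁻¹ * mat ℚ i k').trace = 0 := by
      intro k' hk'
      rw [mul_assoc, mul_assoc, trace_mul_comm, mul_assoc, mul_assoc, ← map_mul, ← map_mul]
      exact h _ (K.mul_mem (K.inv_mem hk) (K.mul_mem hk' hk))
    obtain ⟨r, hr⟩ := exists_eq_smul_of_trace_mul_eq_zero hab hy h0 (h a ha) (h b hb)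
      (by simpa using hconj 1 K.one_mem) (hconj a ha) (hconj b hb)
    rcases eq_one_or_neg_one_of_conj hy hr with rfl | rfl
    · left; rw [hr, one_smul]
    · right; rw [hr, neg_one_smul]

theorem exists_trace_mul_eq_zero {B : Submodule ℚ (Matrix (Fin 2) (Fin 2) ℚ)} (hB : B ≠ ⊤) :
    ∃ y : Matrix (Fin 2) (Fin 2) ℚ, y ≠ 0 ∧ ∀ b ∈ B, (y * b).trace = 0 := by
  obtain ⟨f, hf, hle⟩ := Submodule.exists_le_ker_of_lt_top B (lt_top_iff_ne_top.2 hB)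
  have key : ∀ b, ((of fun a c => f (single c a 1)) * b).trace = f b := by
    intro b
    conv_rhs => rw [matrix_eq_sum_single b]
    simp only [map_sum, trace, diag, mul_apply, of_apply]
    rw [Finset.sum_comm]
    refine Finset.sum_congr rfl fun x _ => Finset.sum_congr rfl fun z _ => ?_
    have : single x z (b x z) = b x z • single x z (1 : ℚ) := by simp
    rw [this, map_smul, smul_eq_mul, mul_comm]
  refine ⟨of fun a c => f (single c a 1), fun h0 => hf ?_, fun b hb => ?_⟩
  · ext1 b
    rw [← key, h0]
    simp
  · rw [key]
    exact hle hb

theorem exists_sum_trace_mul_eq_zero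
    {B : Submodule ℚ (Fin 3 → Matrix (Fin 2) (Fin 2) ℚ)} (hB : B ≠ ⊤) :
    ∃ y : Fin 3 → Matrix (Fin 2) (Fin 2) ℚ, y ≠ 0 ∧
      ∀ b ∈ B, ∑ i, (y i * b i).trace = 0 := by
  obtain ⟨f, hf, hle⟩ := Submodule.exists_le_ker_of_lt_top B (lt_top_iff_ne_top.2 hB)
  have key : ∀ b, ∑ i, ((of fun a c => f (Pi.single i (single c a 1))) * b i).trace = f b := by
    intro b
    conv_rhs => rw [← Finset.univ_sum_single b]
    rw [map_sum]
    refine Finset.sum_congr rfl fun i _ => ?_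
    conv_rhs => rw [matrix_eq_sum_single (b i)]
    have h1 : ∀ M : Matrix (Fin 2) (Fin 2) ℚ,
        f (Pi.single i M) = (f ∘ₗ LinearMap.single ℚ _ i) M := fun M => rfl
    simp only [h1, map_sum, trace, diag, mul_apply, of_apply]
    rw [Finset.sum_comm]
    refine Finset.sum_congr rfl fun x _ => Finset.sum_congr rfl fun z _ => ?_
    have : single x z (b i x z) = b i x z • single x z (1 : ℚ) := by simp
    rw [this, map_smul, smul_eq_mul, mul_comm]
  refine ⟨fun i => of fun a c => f (Pi.single i (single c a 1)), fun h0 => hf ?_, fun b hb => ?_⟩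
  · refine LinearMap.ext fun b => ?_
    rw [LinearMap.zero_apply]
    rw [← key]
    refine Finset.sum_eq_zero fun i _ => ?_
    rw [show (of fun a c => f (Pi.single i (single c a 1))) = 0 from congrFun h0 i]
    simp
  · rw [key]
    exact hle hb

/-- The diagonal embedding of the group into the product of three matrix algebras. -/
def emb : GammaSL →* (Fin 3 → Matrix (Fin 2) (Fin 2) ℚ) := MonoidHom.pi fun i => mat ℚ i

theorem emb_apply (g : GammaSL) (i : Fin 3) : emb g i = mat ℚ i g := rfl

/-- The triples of matrices orthogonal to a subgroup, supported on a set of factors. -/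
def annihilator (K : Subgroup GammaSL) (s : Set (Fin 3)) :
    Submodule ℚ (Fin 3 → Matrix (Fin 2) (Fin 2) ℚ) where
  carrier := {y | (∀ k ∈ K, ∑ i, (y i * mat ℚ i k).trace = 0) ∧ ∀ i ∉ s, y i = 0}
  zero_mem' := ⟨fun k _ => by simp, fun i _ => rfl⟩
  add_mem' {y z} hy hz := ⟨fun k hk => by
    simp only [Pi.add_apply, add_mul, trace_add, Finset.sum_add_distrib, hy.1 k hk, hz.1 k hk,
      add_zero], fun i hi => by rw [Pi.add_apply, hy.2 i hi, hz.2 i hi, add_zero]⟩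
  smul_mem' c y hy := ⟨fun k hk => by
    simp only [Pi.smul_apply, smul_mul_assoc, trace_smul, ← Finset.smul_sum, hy.1 k hk,
      smul_zero], fun i hi => by rw [Pi.smul_apply, hy.2 i hi, smul_zero]⟩

theorem emb_mul_mem_annihilator {K : Subgroup GammaSL} {s : Set (Fin 3)}
    {y : Fin 3 → Matrix (Fin 2) (Fin 2) ℚ} (hy : y ∈ annihilator K s) {k : GammaSL}
    (hk : k ∈ K) : emb k * y ∈ annihilator K s := by
  refine ⟨fun k' hk' => ?_, fun i hi => by rw [Pi.mul_apply, hy.2 i hi, mul_zero]⟩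
  rw [← hy.1 _ (K.mul_mem hk' hk)]
  refine Finset.sum_congr rfl fun i _ => ?_
  rw [Pi.mul_apply, emb_apply, mul_assoc, trace_mul_comm, mul_assoc, ← map_mul]

theorem mul_emb_mem_annihilator {K : Subgroup GammaSL} {s : Set (Fin 3)}
    {y : Fin 3 → Matrix (Fin 2) (Fin 2) ℚ} (hy : y ∈ annihilator K s) {k : GammaSL}
    (hk : k ∈ K) : y * emb k ∈ annihilator K s := by
  refine ⟨fun k' hk' => ?_, fun i hi => by rw [Pi.mul_apply, hy.2 i hi, zero_mul]⟩
  rw [← hy.1 _ (K.mul_mem hk hk')]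
  refine Finset.sum_congr rfl fun i _ => ?_
  rw [Pi.mul_apply, emb_apply, mul_assoc, ← map_mul]

theorem eq_top_of_mul_mem {P : Submodule ℚ (Matrix (Fin 2) (Fin 2) ℚ)}
    {A : Set (Matrix (Fin 2) (Fin 2) ℚ)} (hA : Submodule.span ℚ A = ⊤)
    (hl : ∀ a ∈ A, ∀ p ∈ P, a * p ∈ P) (hr : ∀ a ∈ A, ∀ p ∈ P, p * a ∈ P)
    {p : Matrix (Fin 2) (Fin 2) ℚ} (hp : p ∈ P) (hp0 : p ≠ 0) : P = ⊤ := by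
  have hl' : ∀ a, ∀ p ∈ P, a * p ∈ P := by
    intro a p hp
    have ha : a ∈ Submodule.span ℚ A := hA ▸ Submodule.mem_top
    induction ha using Submodule.span_induction with
    | mem x hx => exact hl x hx p hp
    | zero => rw [zero_mul]; exact P.zero_mem
    | add x y _ _ hx hy => rw [add_mul]; exact P.add_mem hx hy
    | smul c x _ hx => rw [smul_mul_assoc]; exact P.smul_mem c hx
  have hr' : ∀ a, ∀ p ∈ P, p * a ∈ P := by
    intro a p hp
    have ha : a ∈ Submodule.span ℚ A := hA ▸ Submodule.mem_top
    induction ha using Submodule.span_induction with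
    | mem x hx => exact hr x hx p hp
    | zero => rw [mul_zero]; exact P.zero_mem
    | add x y _ _ hx hy => rw [mul_add]; exact P.add_mem hx hy
    | smul c x _ hx => rw [mul_smul_comm]; exact P.smul_mem c hx
  obtain ⟨a, c, hac⟩ : ∃ a c, p a c ≠ 0 := by
    by_contra! hcon
    exact hp0 (by ext a c; exact hcon a c)
  rw [eq_top_iff]
  intro M _
  rw [matrix_eq_sum_single M]
  refine P.sum_mem fun x _ => P.sum_mem fun z _ => ?_
  have h1 := hr' (single c z (1 : ℚ)) _ (hl' (single x a (M x z / p a c)) p hp)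
  rwa [single_mul_mul_single, div_mul_cancel₀ _ hac, mul_one] at h1

/-- A subgroup that does not span the product of the matrix algebras fixes, up to sign, a nonzero
matrix in one of the irreducible pieces of the representation. -/
theorem exists_intertwiner_of_span_ne_top {K : Subgroup GammaSL}
    (hK : Submodule.span ℚ (emb '' (K : Set GammaSL)) ≠ ⊤) :
    ∃ (i j : Fin 3) (X : Matrix (Fin 2) (Fin 2) ℚ), X ≠ 0 ∧ (i = j → X.trace = 0) ∧
      ∀ k ∈ K, mat ℚ i k * X * mat ℚ j k⁻¹ = X ∨ mat ℚ i k * X * mat ℚ j k⁻¹ = -X := by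
  classical
  by_cases hspan : ∀ i, Submodule.span ℚ (mat ℚ i '' (K : Set GammaSL)) = ⊤
  swap
  · push Not at hspan
    obtain ⟨i, hi⟩ := hspan
    obtain ⟨y, hy, h⟩ := exists_trace_mul_eq_zero hi
    obtain ⟨X, hX, htr, hfix⟩ := exists_conj_eq_or_neg_of_trace_mul_eq_zero (i := i) hy
      fun k hk => h _ (Submodule.subset_span ⟨k, hk, rfl⟩)
    exact ⟨i, i, X, hX, fun _ => htr, hfix⟩
  obtain ⟨y₀, hy₀, h₀⟩ := exists_sum_trace_mul_eq_zero hK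
  have hmem : y₀ ∈ {y | y ≠ 0 ∧ y ∈ annihilator K Set.univ} :=
    ⟨hy₀, fun k hk => h₀ _ (Submodule.subset_span ⟨k, hk, rfl⟩), fun i hi => (hi trivial).elim⟩
  obtain ⟨y, ⟨hy, hyN⟩, hmin⟩ := WellFounded.has_min
    (measure fun y : Fin 3 → Matrix (Fin 2) (Fin 2) ℚ =>
      (Finset.univ.filter fun i => y i ≠ 0).card).wf _ ⟨y₀, hmem⟩
  obtain ⟨i, hi⟩ := Function.ne_iff.1 hy
  obtain ⟨j, hij, hj⟩ : ∃ j, j ≠ i ∧ y j ≠ 0 := by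
    by_contra! hcon
    have htr : ∀ b ∈ Submodule.span ℚ (mat ℚ i '' (K : Set GammaSL)), (y i * b).trace = 0 := by
      intro b hb
      induction hb using Submodule.span_induction with
      | mem x hx =>
        obtain ⟨k, hk, rfl⟩ := hx
        have := hyN.1 k hk
        rwa [Finset.sum_eq_single i (fun j _ hj => by rw [hcon j hj, zero_mul, trace_zero])
          (by simp)] at this
      | zero => simp
      | add x z _ _ hx hz => rw [mul_add, trace_add, hx, hz, add_zero]
      | smul c x _ hx => rw [mul_smul_comm, trace_smul, hx, smul_zero]
    apply hi
    ext a c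
    have := htr (single c a 1) (hspan i ▸ Submodule.mem_top)
    rw [trace_mul_single] at this
    simpa using this
  set N := annihilator K {i | y i ≠ 0} with hN
  have hyN' : y ∈ N := ⟨hyN.1, fun i hi => not_not.1 hi⟩
  set π : N →ₗ[ℚ] Matrix (Fin 2) (Fin 2) ℚ := LinearMap.proj i ∘ₗ N.subtype with hπ
  have hinj : Function.Injective π := by
    rw [injective_iff_map_eq_zero]
    intro z hz
    by_contra hz0
    refine hmin z.1 ⟨fun h => hz0 (Subtype.ext h), z.2.1, fun i hi => (hi trivial).elim⟩ ?_
    refine Finset.card_lt_card (Finset.ssubset_iff_of_subset (fun a ha => ?_) |>.2 ⟨i, ?_, ?_⟩)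
    · rw [Finset.mem_filter] at ha ⊢
      exact ⟨ha.1, fun h => ha.2 (z.2.2 a fun h' => h' h)⟩
    · simpa using hi
    · simpa using (show z.1 i = 0 from hz)
  have hsurj : Function.Surjective π := by
    rw [← LinearMap.range_eq_top]
    refine eq_top_of_mul_mem (hspan i) ?_ ?_ (p := y i) ⟨⟨y, hyN'⟩, rfl⟩ hi
    · rintro _ ⟨k, hk, rfl⟩ _ ⟨z, rfl⟩
      exact ⟨⟨_, emb_mul_mem_annihilator z.2 hk⟩, rfl⟩
    · rintro _ ⟨k, hk, rfl⟩ _ ⟨z, rfl⟩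
      exact ⟨⟨_, mul_emb_mem_annihilator z.2 hk⟩, rfl⟩
  set e := LinearEquiv.ofBijective π ⟨hinj, hsurj⟩ with he
  set ψ : Matrix (Fin 2) (Fin 2) ℚ →ₗ[ℚ] Matrix (Fin 2) (Fin 2) ℚ :=
    LinearMap.proj j ∘ₗ N.subtype ∘ₗ e.symm.toLinearMap with hψ
  have hψπ : ∀ z : N, ψ (z.1 i) = z.1 j := by
    intro z
    have : e.symm (z.1 i) = z := by
      rw [LinearEquiv.symm_apply_eq]
      rfl
    simp only [hψ, LinearMap.comp_apply, LinearEquiv.coe_coe]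
    rw [this]
    rfl
  have hψk : ∀ k ∈ K, ∀ M, ψ (mat ℚ i k * M) = mat ℚ j k * ψ M := by
    intro k hk M
    obtain ⟨z, rfl⟩ := hsurj M
    have h1 := hψπ ⟨_, emb_mul_mem_annihilator z.2 hk⟩
    have h2 := hψπ z
    change ψ (mat ℚ i k * z.1 i) = mat ℚ j k * ψ (z.1 i)
    rw [h2]
    exact h1
  obtain ⟨x, b, hxb⟩ : ∃ x b, (of fun a c => ψ (single c x 1) a b) ≠ 0 := by
    by_contra! hcon
    have hψ0 : ∀ M, ψ M = 0 := by
      intro M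
      rw [matrix_eq_sum_single M, map_sum]
      refine Finset.sum_eq_zero fun c _ => ?_
      rw [map_sum]
      refine Finset.sum_eq_zero fun x _ => ?_
      have : single c x (M c x) = M c x • single c x (1 : ℚ) := by simp
      rw [this, map_smul]
      ext a b
      have h1 := congrFun (congrFun (hcon x b) a) c
      rw [of_apply] at h1
      simp [h1]
    exact hj ((hψπ ⟨y, hyN'⟩).symm.trans (hψ0 _))
  refine ⟨j, i, _, hxb, fun h => (hij h).elim, fun k hk => Or.inl ?_⟩
  have hcomm : mat ℚ j k * (of fun a c => ψ (single c x 1) a b) =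
      (of fun a c => ψ (single c x 1) a b) * mat ℚ i k := by
    ext a c
    have h1 : (mat ℚ j k * ψ (single c x 1)) a b =
        ∑ d, ψ (single d x 1) a b * mat ℚ i k d c := by
      rw [← hψk k hk]
      have h2 : mat ℚ i k * single c x 1 = ∑ d, mat ℚ i k d c • single d x (1 : ℚ) := by
        ext p q
        rw [Matrix.sum_apply]
        simp [mul_apply, single_apply]
        fin_cases p <;> fin_cases c <;> fin_cases x <;> fin_cases q <;> simp
      rw [h2, map_sum, Matrix.sum_apply]
      refine Finset.sum_congr rfl fun d _ => ?_
      rw [map_smul, Matrix.smul_apply, smul_eq_mul, mul_comm]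
    simpa only [mul_apply, of_apply] using h1
  rw [hcomm, mul_assoc, mat_mul_inv, mul_one]

theorem finrank_comap_le_of_injective {E : Type*} [AddCommGroup E] [Module ℚ E]
    [FiniteDimensional ℚ E] {f : E →ₗ[ℚ] E} (hf : Function.Injective f) (W : Submodule ℚ E) :
    Module.finrank ℚ (W.comap f) ≤ Module.finrank ℚ W := by
  refine LinearMap.finrank_le_finrank_of_injective
    (f := f.restrict (p := W.comap f) (q := W) fun x hx => hx) ?_
  intro x y hxy
  exact Subtype.ext (hf (congrArg Subtype.val hxy))

theorem emb_mul_inv (g : GammaSL) : emb g * emb g⁻¹ = 1 := by rw [← map_mul]; simp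

theorem emb_inv_mul (g : GammaSL) : emb g⁻¹ * emb g = 1 := by rw [← map_mul]; simp

/-- The left translate of a subspace by the inverse of a group element. -/
def leftTranslate (g : GammaSL) (W : Submodule ℚ (Fin 3 → Matrix (Fin 2) (Fin 2) ℚ)) :
    Submodule ℚ (Fin 3 → Matrix (Fin 2) (Fin 2) ℚ) := W.comap (LinearMap.mulLeft ℚ (emb g))

/-- The right translate of a subspace by the inverse of a group element. -/
def rightTranslate (g : GammaSL) (W : Submodule ℚ (Fin 3 → Matrix (Fin 2) (Fin 2) ℚ)) :
    Submodule ℚ (Fin 3 → Matrix (Fin 2) (Fin 2) ℚ) := W.comap (LinearMap.mulRight ℚ (emb g))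

theorem ExpDecay.exists_nonneg {b : ℕ → ℝ} (hb : ExpDecay b) :
    ∃ b', ExpDecay b' ∧ (∀ l, 0 ≤ b' l) ∧ ∀ l, b l ≤ b' l := by
  obtain ⟨C, ρ, hC, h0, h1, hl⟩ := hb
  exact ⟨fun l => C * ρ ^ l, ⟨C, ρ, hC, h0, h1, fun l => le_rfl⟩, fun l => by positivity, hl⟩

section Stabilizer

variable {W : Submodule ℚ (Fin 3 → Matrix (Fin 2) (Fin 2) ℚ)}

theorem mem_leftTranslate {g : GammaSL} {v : Fin 3 → Matrix (Fin 2) (Fin 2) ℚ} :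
    v ∈ leftTranslate g W ↔ emb g * v ∈ W := Iff.rfl

theorem mem_rightTranslate {g : GammaSL} {v : Fin 3 → Matrix (Fin 2) (Fin 2) ℚ} :
    v ∈ rightTranslate g W ↔ v * emb g ∈ W := Iff.rfl

theorem leftTranslate_one : leftTranslate 1 W = W := by
  ext v
  rw [mem_leftTranslate, map_one, one_mul]

theorem leftTranslate_mul (g h : GammaSL) :
    leftTranslate (g * h) W = leftTranslate h (leftTranslate g W) := by
  ext v
  simp only [mem_leftTranslate, map_mul, mul_assoc]

theorem finrank_leftTranslate (g : GammaSL) :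
    Module.finrank ℚ (leftTranslate g W) = Module.finrank ℚ W := by
  have hle : ∀ (g : GammaSL) (W : Submodule ℚ (Fin 3 → Matrix (Fin 2) (Fin 2) ℚ)),
      Module.finrank ℚ (leftTranslate g W) ≤ Module.finrank ℚ W := by
    intro g W
    refine finrank_comap_le_of_injective (fun x y hxy => ?_) W
    have h : emb g⁻¹ * (emb g * x) = emb g⁻¹ * (emb g * y) := congrArg (emb g⁻¹ * ·) hxy
    rwa [← mul_assoc, ← mul_assoc, emb_inv_mul, one_mul, one_mul] at h
  refine (hle g W).antisymm ?_
  have := hle g⁻¹ (leftTranslate g W)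
  rwa [← leftTranslate_mul, mul_inv_cancel, leftTranslate_one] at this

theorem finrank_rightTranslate_le (g : GammaSL) :
    Module.finrank ℚ (rightTranslate g W) ≤ Module.finrank ℚ W := by
  refine finrank_comap_le_of_injective (fun x y hxy => ?_) W
  have h : x * emb g * emb g⁻¹ = y * emb g * emb g⁻¹ := congrArg (· * emb g⁻¹) hxy
  rwa [mul_assoc, mul_assoc, emb_mul_inv, mul_one, mul_one] at h

/-- The stabilizer of a subspace under left translations. -/
def stab (W : Submodule ℚ (Fin 3 → Matrix (Fin 2) (Fin 2) ℚ)) : Subgroup GammaSL where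
  carrier := {k | leftTranslate k W = W}
  one_mem' := leftTranslate_one
  mul_mem' {a b} ha hb := by
    rw [Set.mem_ofPred_eq] at *
    rw [leftTranslate_mul, ha, hb]
  inv_mem' {a} ha := by
    rw [Set.mem_ofPred_eq] at *
    conv_lhs => rw [← ha]
    rw [← leftTranslate_mul, mul_inv_cancel, leftTranslate_one]

theorem mem_stab {k : GammaSL} : k ∈ stab W ↔ leftTranslate k W = W := Iff.rfl

theorem exists_intertwiner_of_stab (hW : W ≠ ⊤) {g₀ : GammaSL} (hg₀ : emb g₀ ∈ W) :
    ∃ (i j : Fin 3), ∃ X ∈ pairSpace i j, X ≠ 0 ∧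
      ∀ k ∈ stab W, pairAct i j k X = X ∨ pairAct i j k X = -X := by
  obtain ⟨i, j, X, hX, htr, hfix⟩ := exists_intertwiner_of_span_ne_top (K := stab W) (by
    intro hspan
    apply hW
    have hmul : ∀ v w, w ∈ W → v * w ∈ W := by
      intro v w hw
      have hv : v ∈ Submodule.span ℚ (emb '' (stab W : Set GammaSL)) := hspan ▸ Submodule.mem_top
      induction hv using Submodule.span_induction with
      | mem x hx =>
        obtain ⟨k, hk, rfl⟩ := hx
        have : w ∈ leftTranslate k W := by rwa [mem_stab.1 hk]
        exact this
      | zero => rw [zero_mul]; exact W.zero_mem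
      | add x y _ _ hx hy => rw [add_mul]; exact W.add_mem hx hy
      | smul c x _ hx => rw [smul_mul_assoc]; exact W.smul_mem c hx
    rw [eq_top_iff]
    intro v _
    have := hmul (v * emb g₀⁻¹) _ hg₀
    rwa [mul_assoc, emb_inv_mul, mul_one] at this)
  have hmap : ∀ i k, mat ℝ i k = (mat ℚ i k).map (algebraMap ℚ ℝ) := by
    intro i k
    ext a b
    simp [mat_apply]
  have hact : ∀ k, pairAct i j k (X.map (algebraMap ℚ ℝ)) =
      (mat ℚ i k * X * mat ℚ j k⁻¹).map (algebraMap ℚ ℝ) := by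
    intro k
    rw [pairAct_apply, hmap, hmap, Matrix.map_mul, Matrix.map_mul]
  refine ⟨i, j, X.map (algebraMap ℚ ℝ), ?_, ?_, fun k hk => ?_⟩
  · rw [mem_pairSpace]
    intro h
    have := htr h
    rw [trace_fin_two] at this ⊢
    simp only [map_apply, ← map_add, this, map_zero]
  · intro h0
    apply hX
    ext a b
    have := congrFun (congrFun h0 a) b
    simpa using this
  · rw [hact]
    rcases hfix k hk with h | h
    · left; rw [h]
    · right; rw [h]; ext a b; simp

open Classical in
theorem exists_expDecay_stab {S : Finset GammaSL} (hsym : (S : Set GammaSL)⁻¹ = S)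
    (hS : S.Nonempty) (hH : ZariskiDense (Subgroup.closure (S : Set GammaSL))) :
    ∃ b, ExpDecay b ∧ (∀ l, 0 ≤ b l) ∧
      ∀ W : Submodule ℚ (Fin 3 → Matrix (Fin 2) (Fin 2) ℚ), W ≠ ⊤ → (∃ g, emb g ∈ W) →
        ∀ l, walkE S (l + l) (fun g => if g ∈ stab W then 1 else 0) ≤ b l := by
  have h1 : ∀ i j, ∃ b, ExpDecay b ∧ (∀ l, 0 ≤ b l) ∧ ∀ X ∈ pairSpace i j, X ≠ 0 → ∀ l,
      walkE S (l + l) (fun g => if pairAct i j g X = X ∨ pairAct i j g X = -X then 1 else 0)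
        ≤ b l := by
    intro i j
    obtain ⟨b, hb, h⟩ := exists_expDecay_eq_or_neg hsym hS hH i j
    obtain ⟨b', hb', h0, hle⟩ := hb.exists_nonneg
    exact ⟨b', hb', h0, fun X hX hX0 l => by
      refine le_trans (le_of_eq ?_) ((h X hX hX0 l).trans (hle l))
      congr!⟩
  choose b hb h0 hle using h1
  refine ⟨fun l => ∑ i, ∑ j, b i j l, ExpDecay.sum _ fun i => ExpDecay.sum _ fun j => hb i j,
    fun l => Finset.sum_nonneg fun i _ => Finset.sum_nonneg fun j _ => h0 i j l,
    fun W hW hg l => ?_⟩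
  obtain ⟨g₀, hg₀⟩ := hg
  obtain ⟨i, j, X, hX, hX0, hfix⟩ := exists_intertwiner_of_stab hW hg₀
  calc _ ≤ walkE S (l + l)
        (fun g => if pairAct i j g X = X ∨ pairAct i j g X = -X then 1 else 0) := by
        refine walkE_mono hS _ fun g => ?_
        by_cases hg : g ∈ stab W
        · rw [if_pos hg, if_pos (hfix g hg)]
        · rw [if_neg hg]; split_ifs <;> norm_num
    _ ≤ b i j l := hle i j X hX hX0 l
    _ ≤ ∑ j, b i j l :=
        Finset.single_le_sum (f := fun j => b i j l) (fun j _ => h0 i j l) (Finset.mem_univ j)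
    _ ≤ _ := Finset.single_le_sum (f := fun i => ∑ j, b i j l)
        (fun i _ => Finset.sum_nonneg fun j _ => h0 i j l) (Finset.mem_univ i)

open Classical in
/-- Two independent walks land in translates of a subspace that either coincide or meet in a
smaller subspace. -/
theorem walkE_mem_sq_le {S : Finset GammaSL} (hsym : (S : Set GammaSL)⁻¹ = S) (hS : S.Nonempty)
    {β : ℝ} (hβ : 0 ≤ β) (l : ℕ) (hW : ∀ W' : Submodule ℚ (Fin 3 → Matrix (Fin 2) (Fin 2) ℚ),
      Module.finrank ℚ W' < Module.finrank ℚ W →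
        walkE S l (fun g => if emb g ∈ W' then 1 else 0) ≤ β) :
    walkE S (l + l) (fun g => if emb g ∈ W then 1 else 0) ^ 2 ≤
      walkE S (l + l) (fun g => if g ∈ stab W then 1 else 0) + β := by
  have hsym' : ∀ s, s ∈ S → s⁻¹ ∈ S := by
    intro s hs
    have : s ∈ (S : Set GammaSL)⁻¹ := by rw [hsym]; exact hs
    exact this
  set f : GammaSL → GammaSL → ℝ := fun h k => if emb (h * k) ∈ W then 1 else 0 with hf
  have hpair : ∀ h h', walkE S l (fun k => f h k * f h' k) ≤
      (if h * h'⁻¹ ∈ stab W then 1 else 0) + β := by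
    intro h h'
    by_cases hst : h * h'⁻¹ ∈ stab W
    · rw [if_pos hst]
      calc _ ≤ walkE S l (fun _ => (1 : ℝ)) := by
            refine walkE_mono hS _ fun k => ?_
            simp only [hf]
            split_ifs <;> norm_num
        _ = 1 := walkE_const hS _ _
        _ ≤ 1 + β := by linarith
    · rw [if_neg hst, zero_add]
      have hne : leftTranslate h W ≠ leftTranslate h' W := by
        intro he
        apply hst
        rw [mem_stab, leftTranslate_mul, he, ← leftTranslate_mul, mul_inv_cancel,
          leftTranslate_one]
      have hlt : Module.finrank ℚ (leftTranslate h W ⊓ leftTranslate h' W :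
          Submodule ℚ (Fin 3 → Matrix (Fin 2) (Fin 2) ℚ)) < Module.finrank ℚ W := by
        rw [← finrank_leftTranslate (W := W) h]
        refine Submodule.finrank_lt_finrank_of_lt (inf_le_left.lt_of_ne fun he => hne ?_)
        refine Submodule.eq_of_le_of_finrank_eq (inf_eq_left.1 he) ?_
        rw [finrank_leftTranslate, finrank_leftTranslate]
      refine le_trans (walkE_mono hS _ fun k => ?_) (hW _ hlt)
      simp only [hf, Submodule.mem_inf, mem_leftTranslate, map_mul]
      split_ifs <;> simp_all
  have hsq : ∀ k, walkE S l (fun h => f h k) ^ 2 =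
      walkE S l (fun h => walkE S l (fun h' => f h k * f h' k)) := by
    intro k
    simp only [walkE_const_mul hS]
    simp only [mul_comm _ (walkE S l fun h' => f h' k), walkE_const_mul hS, sq]
  calc _ = walkE S l (fun k => walkE S l (fun h => f h k)) ^ 2 := by
        rw [walkE_add hS, walkE_comm hS]
    _ ≤ walkE S l (fun k => walkE S l (fun h => f h k) ^ 2) := walkE_sq_le hS _ _
    _ = walkE S l (fun h => walkE S l (fun h' => walkE S l (fun k => f h k * f h' k))) := by
        simp only [hsq]
        rw [walkE_comm hS]
        congr 1
        funext h
        rw [walkE_comm hS]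
    _ ≤ walkE S l (fun h => walkE S l
          (fun h' => (if h * h'⁻¹ ∈ stab W then 1 else 0) + β)) :=
        walkE_mono hS _ fun h => walkE_mono hS _ fun h' => hpair h h'
    _ = _ := by
        simp only [walkE_add_fun hS, walkE_const hS]
        rw [walkE_add hS]
        congr 2
        funext h
        exact walkE_inv hS hsym' l (fun h' => if h * h' ∈ stab W then 1 else 0)

end Stabilizer

open Classical in
theorem exists_expDecay_mem {S : Finset GammaSL} (hsym : (S : Set GammaSL)⁻¹ = S)
    (hS : S.Nonempty) (hH : ZariskiDense (Subgroup.closure (S : Set GammaSL))) (d : ℕ) :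
    ∃ b, ExpDecay b ∧ (∀ l, 0 ≤ b l) ∧
      ∀ W : Submodule ℚ (Fin 3 → Matrix (Fin 2) (Fin 2) ℚ),
        Module.finrank ℚ W < Module.finrank ℚ (Fin 3 → Matrix (Fin 2) (Fin 2) ℚ) →
        Module.finrank ℚ W ≤ d →
        ∀ l, walkE S l (fun g => if emb g ∈ W then 1 else 0) ≤ b l := by
  have hnone : ∀ W : Submodule ℚ (Fin 3 → Matrix (Fin 2) (Fin 2) ℚ), (¬ ∃ g, emb g ∈ W) → ∀ l,
      walkE S l (fun g => if emb g ∈ W then (1 : ℝ) else 0) = 0 := by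
    intro W hW l
    rw [show (fun g => if emb g ∈ W then (1 : ℝ) else 0) = fun _ => 0 from
      funext fun g => if_neg fun hg => hW ⟨g, hg⟩]
    exact walkE_const hS l 0
  induction d with
  | zero =>
    refine ⟨fun _ => 0, ⟨0, 1 / 2, le_rfl, by norm_num, by norm_num, fun l => by simp⟩,
      fun _ => le_rfl, fun W _ hW0 l => (hnone W ?_ l).le⟩
    rintro ⟨g, hg⟩
    rw [Submodule.finrank_eq_zero.1 (Nat.le_zero.1 hW0), Submodule.mem_bot] at hg
    have := emb_mul_inv g
    rw [hg, zero_mul] at this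
    exact zero_ne_one this
  | succ d ih =>
    obtain ⟨b, hb, hb0, h⟩ := ih
    obtain ⟨b', hb', hb0', h'⟩ := exists_expDecay_stab hsym hS hH
    have heven : ∀ W : Submodule ℚ (Fin 3 → Matrix (Fin 2) (Fin 2) ℚ),
        Module.finrank ℚ W < Module.finrank ℚ (Fin 3 → Matrix (Fin 2) (Fin 2) ℚ) →
        Module.finrank ℚ W ≤ d + 1 → ∀ m,
        walkE S (m + m) (fun g => if emb g ∈ W then 1 else 0) ≤ √(b' m + b m) := by
      intro W hW hWd m
      by_cases hg : ∃ g, emb g ∈ W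
      · apply Real.le_sqrt_of_sq_le
        refine (walkE_mem_sq_le hsym hS (hb0 m) m fun W' hW' => h W' (hW'.trans hW)
          (by omega) m).trans ?_
        gcongr
        exact h' W (by rintro rfl; rw [finrank_top] at hW; exact lt_irrefl _ hW) hg m
      · rw [hnone W hg]
        positivity
    refine ⟨fun l => √(b' (l / 2) + b (l / 2)), (expDecay_div (hb'.add hb) two_pos).sqrt,
      fun l => by positivity, fun W hW hWd l => ?_⟩
    obtain ⟨m, rfl | rfl⟩ := Nat.even_or_odd' l
    · beta_reduce
      rw [show 2 * m / 2 = m by omega, two_mul]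
      exact heven W hW hWd m
    · beta_reduce
      rw [show (2 * m + 1) / 2 = m by omega, two_mul]
      simp only [walkE]
      have hle : ∀ s ∈ S, walkE S (m + m) (fun g => if emb (g * s) ∈ W then (1 : ℝ) else 0) ≤
          √(b' m + b m) := by
        intro s _
        have hfr := finrank_rightTranslate_le (W := W) s
        have := heven (rightTranslate s W) (hfr.trans_lt hW) (hfr.trans hWd) m
        simpa only [mem_rightTranslate, ← map_mul] using this
      have hc : (0 : ℝ) < S.card := by exact_mod_cast hS.card_pos
      rw [inv_mul_le_iff₀ hc, ← nsmul_eq_mul]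
      exact Finset.sum_le_card_nsmul _ _ _ hle

theorem chiIter_finsum_mul {S : Set GammaSL} (hfin : S.Finite) (l : ℕ) :
    (Function.support (chiIter S l)).Finite ∧
      ∀ F : GammaSL → ℝ, ∑ᶠ g, chiIter S l g * F g = walkE hfin.toFinset l F := by
  classical
  induction l with
  | zero =>
    refine ⟨(Set.finite_singleton (1 : GammaSL)).subset fun x hx => ?_, fun F => ?_⟩
    · by_contra h
      exact hx (if_neg h)
    · rw [finsum_eq_single _ 1 fun x hx => by
          rw [chiIter]; beta_reduce; rw [if_neg hx, zero_mul]]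
      simp [chiIter, walkE]
  | succ l ih =>
    obtain ⟨hsupp, hsum⟩ := ih
    have hchi : ∀ x, chiIter S (l + 1) x =
        ∑ y ∈ hfin.toFinset, (hfin.toFinset.card : ℝ)⁻¹ * chiIter S l (x * y⁻¹) := by
      intro x
      change ∑ᶠ y, chiS S y * chiIter S l (x * y⁻¹) = _
      rw [finsum_eq_sum_of_support_subset (s := hfin.toFinset)]
      · refine Finset.sum_congr rfl fun y hy => ?_
        rw [chiS, Set.indicator_of_mem (hfin.mem_toFinset.1 hy), Set.ncard_eq_toFinset_card S hfin]
      · intro y hy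
        by_contra h
        apply hy
        rw [chiS]
        beta_reduce
        rw [Set.indicator_of_notMem (by simpa using h), zero_mul]
    have hsupp' : ∀ y : GammaSL, (Function.support fun x => chiIter S l (x * y⁻¹)).Finite := by
      intro y
      refine (hsupp.image (· * y)).subset fun x hx => ⟨x * y⁻¹, hx, by simp⟩
    refine ⟨(hfin.toFinset.finite_toSet.biUnion fun y _ => hsupp' y).subset fun x hx => ?_,
      fun F => ?_⟩
    · rw [Function.mem_support, hchi] at hx
      obtain ⟨y, hy, hne⟩ := Finset.exists_ne_zero_of_sum_ne_zero hx
      exact Set.mem_biUnion hy (right_ne_zero_of_mul hne)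
    · simp only [hchi, Finset.sum_mul]
      rw [finsum_sum_comm]
      · rw [walkE, Finset.mul_sum]
        refine Finset.sum_congr rfl fun y _ => ?_
        rw [← hsum, ← finsum_comp_equiv (Equiv.mulRight y), ← smul_eq_mul, smul_finsum]
        refine finsum_congr fun z => ?_
        simp [mul_assoc]
      · intro y _
        refine (hsupp' y).subset fun x hx => ?_
        exact right_ne_zero_of_mul (left_ne_zero_of_mul hx)

open Classical in
theorem finsum_mem_chiIter {S : Set GammaSL} (hfin : S.Finite) (l : ℕ) (A : Set GammaSL) :
    ∑ᶠ g ∈ A, chiIter S l g = walkE hfin.toFinset l (fun g => if g ∈ A then 1 else 0) := by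
  rw [← (chiIter_finsum_mul hfin l).2]
  refine finsum_congr fun g => ?_
  by_cases hg : g ∈ A <;> simp [hg]

theorem ZariskiDense.nonempty {S : Set GammaSL} (h : ZariskiDense (Subgroup.closure S)) :
    S.Nonempty := by
  rw [Set.nonempty_iff_ne_empty]
  rintro rfl
  have h1 := h (MvPolynomial.X (0, 0, 1)) (fun g hg => by
    rw [Subgroup.closure_empty, Subgroup.mem_bot] at hg
    rw [hg, MvPolynomial.aeval_X]
    exact Int.cast_zero) (⟨!![1, 1; 0, 1], by simp [det_fin_two_of]⟩, 1, 1)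
  rw [MvPolynomial.aeval_X] at h1
  exact one_ne_zero h1

/-- The linear functional on triples of matrices given by a linear form. -/
noncomputable def formFun (X : Fin 3 × Fin 2 × Fin 2 → ℤ) :
    (Fin 3 → Matrix (Fin 2) (Fin 2) ℚ) →ₗ[ℚ] ℚ where
  toFun Y := ∑ p, (X p : ℚ) * Y p.1 p.2.1 p.2.2
  map_add' Y Z := by simp [mul_add, Finset.sum_add_distrib]
  map_smul' c Y := by
    simp only [Finset.mul_sum, RingHom.id_apply, Pi.smul_apply, Matrix.smul_apply, smul_eq_mul,
      mul_left_comm]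

theorem formFun_emb (X : Fin 3 × Fin 2 × Fin 2 → ℤ) (g : GammaSL) :
    formFun X (emb g) = Lform X g := by
  change ∑ p, (X p : ℚ) * emb g p.1 p.2.1 p.2.2 = _
  simp [Lform, emb_apply, mat_apply_eq_entryZ]

theorem ker_formFun_ne_top {X : Fin 3 × Fin 2 × Fin 2 → ℤ} (hX : PrimitiveForm X) :
    LinearMap.ker (formFun X) ≠ ⊤ := by
  intro h
  rw [LinearMap.ker_eq_top] at h
  have h0 : X = 0 := by
    ext ⟨i, a, b⟩
    have h1 := LinearMap.congr_fun h (Pi.single i (single a b 1))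
    change ∑ p, (X p : ℚ) * (Pi.single i (single a b 1) : Fin 3 → Matrix (Fin 2) (Fin 2) ℚ)
      p.1 p.2.1 p.2.2 = 0 at h1
    rw [Finset.sum_eq_single (i, a, b)] at h1
    · simpa using h1
    · rintro ⟨j, c, d⟩ - hne
      by_cases hj : j = i
      · subst hj
        simp only [Pi.single_eq_same, single_apply]
        rw [if_neg, mul_zero]
        rintro ⟨rfl, rfl⟩
        exact hne rfl
      · simp [Pi.single_eq_of_ne hj]
    · simp
  rw [PrimitiveForm, h0, show Finset.univ.gcd (0 : Fin 3 × Fin 2 × Fin 2 → ℤ) = 0 from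
    Finset.gcd_eq_zero_iff.2 fun _ _ => rfl] at hX
  exact zero_ne_one hX

theorem ExpDecay.exists_lt_exp {b : ℕ → ℝ} (hb : ExpDecay b) :
    ∃ c : ℝ, 0 < c ∧ ∃ l₀ : ℕ, 0 < l₀ ∧ ∀ l, l₀ ≤ l → b l < Real.exp (-c * l) := by
  obtain ⟨C, ρ, hC, h0, h1, hl⟩ := hb
  have hlog : Real.log ρ < 0 := Real.log_neg h0 h1
  have hσ : Real.exp (Real.log ρ / 2) < 1 := by rw [Real.exp_lt_one_iff]; linarith
  have hlim := (tendsto_pow_atTop_nhds_zero_of_lt_one (Real.exp_pos _).le hσ).const_mul C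
  rw [mul_zero] at hlim
  obtain ⟨l₀, hl₀⟩ := Filter.eventually_atTop.1 (hlim.eventually (gt_mem_nhds one_pos))
  refine ⟨-(Real.log ρ / 2), by linarith, l₀ + 1, l₀.succ_pos, fun l hll => (hl l).trans_lt ?_⟩
  have hρ : ρ = Real.exp (Real.log ρ / 2) * Real.exp (Real.log ρ / 2) := by
    rw [← Real.exp_add, add_halves, Real.exp_log h0]
  rw [neg_neg, mul_comm _ (l : ℝ), Real.exp_nat_mul, hρ, mul_pow, ← mul_assoc, ← hρ]
  exact mul_lt_of_lt_one_left (by positivity) (hl₀ l (by omega))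

theorem exists_chiIter_lt_exp (S : Set GammaSL) (hfin : S.Finite) (hsym : S⁻¹ = S)
    (hdense : ZariskiDense (Subgroup.closure S)) :
    ∃ c : ℝ, 0 < c ∧ ∃ l₀ : ℕ, 0 < l₀ ∧ ∀ X, PrimitiveForm X → ∀ l, l₀ ≤ l →
      (∑ᶠ g ∈ {g : GammaSL | Lform X g = 0}, chiIter S l g) < Real.exp (-c * l) := by
  have hS : (hfin.toFinset : Set GammaSL) = S := hfin.coe_toFinset
  obtain ⟨b, hb, -, h⟩ := exists_expDecay_mem (S := hfin.toFinset) (by rw [hS, hsym])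
    (by simpa using ZariskiDense.nonempty hdense) (by rwa [hS])
    (Module.finrank ℚ (Fin 3 → Matrix (Fin 2) (Fin 2) ℚ))
  obtain ⟨c, hc, l₀, hl₀, hlt⟩ := hb.exists_lt_exp
  refine ⟨c, hc, l₀, hl₀, fun X hX l hl => lt_of_le_of_lt ?_ (hlt l hl)⟩
  rw [finsum_mem_chiIter hfin]
  have hker := ker_formFun_ne_top hX
  refine le_trans (le_of_eq ?_) (h _ (Submodule.finrank_lt hker)
    (Submodule.finrank_le _) l)
  congr! 2 with g
  rw [LinearMap.mem_ker, formFun_emb, Int.cast_eq_zero]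
  rfl

end SL2Walk

/-- Exponential non-concentration of the random walk on the zero set
of a primitive linear form. -/
theorem statement10 (S : Set GammaSL) (hfin : S.Finite) (hsym : S⁻¹ = S)
    (hdense : ZariskiDense (Subgroup.closure S)) :
    ∃ c : ℝ, 0 < c ∧ ∃ l₀ : ℕ, 0 < l₀ ∧
      ∀ X : Fin 3 × Fin 2 × Fin 2 → ℤ, PrimitiveForm X →
        ∀ l : ℕ, l₀ ≤ l →
          (∑ᶠ g ∈ {g : GammaSL | Lform X g = 0}, chiIter S l g) < Real.exp (-c * l) :=
  SL2Walk.exists_chiIter_lt_exp S hfin hsym hdense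
end

section
/- Let p₁, p₂ be primes, and let 0 ≤ m₁ ≤ n₁ and 1 ≤ m₂ ≤ n₂ be integers. Let K(p₁^{m₁}, p₁^{n₁}) denote the kernel of SL₂(ℤ/p₁^{n₁}ℤ) → SL₂(ℤ/p₁^{m₁}ℤ) and K(p₂^{m₂}, p₂^{n₂}) the kernel of SL₂(ℤ/p₂^{n₂}ℤ) → SL₂(ℤ/p₂^{m₂}ℤ). Suppose h: K(p₁^{m₁}, p₁^{n₁}) → K(p₂^{m₂}, p₂^{n₂}) is a group homomorphism and ξ ∈ K(p₁^{m₁}, p₁^{n₁}) satisfies h(ξ) ≠ 1. Then p₁ = p₂, and if x is the largest integer such that every entry of ξ − I (in ℤ/p₁^{n₁}ℤ) is divisible by p₁^x (so x < n₁ since ξ ≠ I), then x ≤ m₁ + n₂ − m₂. -/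
open Matrix

/-- The kernel `K(p^m, p^n)` of the entrywise reduction map
`SL₂(ℤ/pⁿℤ) → SL₂(ℤ/p^mℤ)` (for `m ≤ n`). -/
def SLkerPow (p m n : ℕ) (h : m ≤ n) :
    Subgroup (Matrix.SpecialLinearGroup (Fin 2) (ZMod (p ^ n))) :=
  MonoidHom.ker
    (Matrix.SpecialLinearGroup.map (ZMod.castHom (pow_dvd_pow p h) (ZMod (p ^ m))))

/-- The unipotent matrix `1 + s • !![-xy, x²; -y², xy]` fixing the vector `(x, y)`. -/
def slUnipotent {R : Type*} [CommRing R] (x y s : R) :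
    Matrix.SpecialLinearGroup (Fin 2) R :=
  ⟨!![1 - s * (x * y), s * x ^ 2; -(s * y ^ 2), 1 + s * (x * y)], by
    rw [det_fin_two_of]; ring⟩

theorem coe_slUnipotent {R : Type*} [CommRing R] (x y s : R) :
    (slUnipotent x y s : Matrix (Fin 2) (Fin 2) R) =
      !![1 - s * (x * y), s * x ^ 2; -(s * y ^ 2), 1 + s * (x * y)] :=
  rfl

theorem slUnipotent_mul {R : Type*} [CommRing R] (x y s t : R) :
    slUnipotent x y s * slUnipotent x y t = slUnipotent x y (s + t) := by
  ext i j
  fin_cases i <;> fin_cases j <;>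
    simp [coe_slUnipotent, Matrix.mul_apply, Fin.sum_univ_two] <;> ring

theorem slUnipotent_pow {R : Type*} [CommRing R] (x y s : R) (k : ℕ) :
    slUnipotent x y s ^ k = slUnipotent x y (k * s) := by
  induction k with
  | zero =>
    ext i j
    fin_cases i <;> fin_cases j <;> simp [coe_slUnipotent]
  | succ k ih =>
    rw [pow_succ, ih, slUnipotent_mul]
    congr 1
    push_cast
    ring

/-- A subgroup of `SL₂(R)` containing all unipotents `slUnipotent x y (c * t)` contains every
matrix congruent to `1` modulo `c` whose upper left entry is a unit. -/
theorem mem_of_forall_slUnipotent_mem {R : Type*} [CommRing R]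
    (H : Subgroup (Matrix.SpecialLinearGroup (Fin 2) R)) (c : R)
    (hH : ∀ x y t, slUnipotent x y (c * t) ∈ H) (g : Matrix.SpecialLinearGroup (Fin 2) R)
    (hg : ∀ i j, c ∣ g.1 i j - (1 : Matrix (Fin 2) (Fin 2) R) i j)
    (hu : IsUnit (g.1 0 0)) : g ∈ H := by
  obtain ⟨α, hα⟩ := hg 0 0
  obtain ⟨β, hβ⟩ := hg 0 1
  obtain ⟨γ, hγ⟩ := hg 1 0
  obtain ⟨v, hv⟩ := hu.exists_right_inv
  have hdet := g.2
  rw [det_fin_two] at hdet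
  simp only [one_apply_eq, ne_eq, zero_ne_one, one_ne_zero, not_false_eq_true, one_apply_ne,
    sub_zero] at hα hβ hγ
  have key : g = slUnipotent 0 1 (c * (-((γ - α) * v))) * slUnipotent 1 1 (c * (-α)) *
      slUnipotent 1 0 (c * ((β + α) * v)) := by
    have ha : g.1 0 0 = 1 + c * α := by linear_combination hα
    rw [ha] at hv hdet
    rw [hβ, hγ] at hdet
    ext i j
    fin_cases i <;> fin_cases j <;>
      simp only [coe_slUnipotent, Matrix.SpecialLinearGroup.coe_mul, Matrix.mul_apply, Fin.sum_univ_two,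
        Fin.zero_eta, Fin.mk_one, Fin.isValue, of_apply, cons_val', cons_val_zero, cons_val_one,
        cons_val_fin_one]
    · linear_combination ha
    · linear_combination hβ - c * (β + α) * hv
    · linear_combination hγ - c * (γ - α) * hv
    · linear_combination v * hdet +
        (-g.1 1 1 + 1 - c * α - c ^ 2 * (γ - α) * (β + α) * v) * hv
  rw [key]
  exact H.mul_mem (H.mul_mem (hH _ _ _) (hH _ _ _)) (hH _ _ _)

theorem exists_one_add_prime_pow_mul_pow {S : Type*} [Ring S] {p : ℕ} (hp : p.Prime) {k : ℕ}
    (hk : 1 ≤ k) (y : S) (d : ℕ) :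
    ∃ z : S, (1 + (p : S) ^ k * y) ^ (p ^ d) = 1 + (p : S) ^ (k + d) * z := by
  induction d with
  | zero => exact ⟨y, by simp⟩
  | succ d ih =>
    obtain ⟨z, hz⟩ := ih
    obtain ⟨r, hr⟩ := (Commute.one_left ((p : S) ^ (k + d) * z)).exists_add_pow_prime_eq hp
    have hc : Commute ((p : S) ^ (k + d)) z := (Nat.cast_commute p z).pow_left _
    have hle : k + (d + 1) ≤ (k + d) * p := by
      have := hp.two_le
      nlinarith
    obtain ⟨e, he⟩ := Nat.exists_eq_add_of_le hle
    refine ⟨(p : S) ^ e * z ^ p + z * r, ?_⟩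
    rw [pow_succ p, pow_mul, hz, hr, one_pow, hc.mul_pow, ← pow_mul, he, mul_one, mul_add,
      pow_add _ (k + (d + 1)) e, ← add_assoc k d 1, pow_succ' _ (k + d)]
    simp only [mul_assoc, add_assoc]

theorem ZMod.dvd_of_castHom_eq_zero {a b : ℕ} [NeZero b] (hab : a ∣ b) {z : ZMod b}
    (hz : ZMod.castHom hab (ZMod a) z = 0) : (a : ZMod b) ∣ z := by
  rw [← ZMod.natCast_zmod_val z, map_natCast, ZMod.natCast_eq_zero_iff] at hz
  rw [← ZMod.natCast_zmod_val z]
  exact Nat.cast_dvd_cast hz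

theorem mem_SLkerPow_iff {p m n : ℕ} (hp : p.Prime) (h : m ≤ n)
    (g : Matrix.SpecialLinearGroup (Fin 2) (ZMod (p ^ n))) :
    g ∈ SLkerPow p m n h ↔
      ∀ i j, (p : ZMod (p ^ n)) ^ m ∣ g.1 i j - (1 : Matrix (Fin 2) (Fin 2) _) i j := by
  have : NeZero (p ^ n) := ⟨pow_ne_zero _ hp.ne_zero⟩
  have hone (i j : Fin 2) : ZMod.castHom (pow_dvd_pow p h) (ZMod (p ^ m))
      ((1 : Matrix (Fin 2) (Fin 2) (ZMod (p ^ n))) i j) = (1 : Matrix (Fin 2) (Fin 2) _) i j := by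
    rw [one_apply, one_apply]
    split_ifs
    · exact map_one _
    · exact map_zero _
  rw [SLkerPow, MonoidHom.mem_ker, Matrix.SpecialLinearGroup.ext_iff]
  refine forall₂_congr fun i j => ?_
  rw [Matrix.SpecialLinearGroup.map_apply_coe, RingHom.mapMatrix_apply, map_apply,
    Matrix.SpecialLinearGroup.coe_one, ← hone, ← sub_eq_zero, ← map_sub]
  constructor
  · intro hz
    exact_mod_cast ZMod.dvd_of_castHom_eq_zero _ hz
  · rintro ⟨w, hw⟩
    rw [hw, map_mul, map_pow, map_natCast, ← Nat.cast_pow, ZMod.natCast_self, zero_mul]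

theorem slUnipotent_mem_SLkerPow {p m n : ℕ} (hp : p.Prime) (h : m ≤ n) (x y t : ZMod (p ^ n)) :
    slUnipotent x y ((p : ZMod (p ^ n)) ^ m * t) ∈ SLkerPow p m n h := by
  rw [mem_SLkerPow_iff hp]
  intro i j
  fin_cases i <;> fin_cases j <;> simp [coe_slUnipotent, mul_assoc]

theorem SLkerPow_pow_eq_one {p m n : ℕ} (hp : p.Prime) (hm : 1 ≤ m) (h : m ≤ n)
    (g : SLkerPow p m n h) : g ^ (p ^ (n - m)) = 1 := by
  have hg := (mem_SLkerPow_iff hp h g.1).1 g.2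
  choose A hA using hg
  have hA' : g.1.1 = 1 + (p : Matrix (Fin 2) (Fin 2) (ZMod (p ^ n))) ^ m * of A := by
    ext i j
    rw [← Nat.cast_pow, ← nsmul_eq_mul, Matrix.add_apply, Matrix.smul_apply, of_apply, nsmul_eq_mul,
      Nat.cast_pow, ← hA]
    ring
  obtain ⟨z, hz⟩ := exists_one_add_prime_pow_mul_pow hp hm (of A) (n - m)
  apply Subtype.ext
  apply Subtype.ext
  change ((g.1 ^ p ^ (n - m) : Matrix.SpecialLinearGroup (Fin 2) (ZMod (p ^ n))) :
    Matrix (Fin 2) (Fin 2) (ZMod (p ^ n))) = 1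
  rw [Matrix.SpecialLinearGroup.coe_pow, hA', hz, Nat.add_sub_cancel' h, ← Nat.cast_pow,
    CharP.cast_eq_zero, zero_mul, add_zero]

theorem ZMod.isNilpotent_natCast_prime_pow (p n : ℕ) : IsNilpotent (p : ZMod (p ^ n)) :=
  ⟨n, by rw [← Nat.cast_pow, ZMod.natCast_self]⟩

theorem ZMod.isUnit_or_isNilpotent_of_prime_pow {p : ℕ} (hp : p.Prime) (n : ℕ)
    (a : ZMod (p ^ n)) : IsUnit a ∨ IsNilpotent a := by
  have : NeZero (p ^ n) := ⟨pow_ne_zero _ hp.ne_zero⟩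
  rw [← ZMod.natCast_zmod_val a]
  rcases Nat.coprime_or_dvd_of_prime hp a.val with hc | ⟨k, hk⟩
  · exact .inl ((ZMod.isUnit_iff_coprime _ _).2 (hc.symm.pow_right n))
  · right
    rw [hk, Nat.cast_mul]
    exact (Commute.all _ _).isNilpotent_mul_right (ZMod.isNilpotent_natCast_prime_pow p n)

/-- Over `ℤ/pⁿ`, a subgroup containing all unipotents `slUnipotent x y (p ^ k * t)` contains the
principal congruence kernel of level `p ^ k`. -/
theorem mem_of_forall_slUnipotent_prime_pow_mem {p k n : ℕ} (hp : p.Prime)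
    (H : Subgroup (Matrix.SpecialLinearGroup (Fin 2) (ZMod (p ^ n))))
    (hH : ∀ x y t, slUnipotent x y ((p : ZMod (p ^ n)) ^ k * t) ∈ H)
    (g : Matrix.SpecialLinearGroup (Fin 2) (ZMod (p ^ n)))
    (hg : ∀ i j, (p : ZMod (p ^ n)) ^ k ∣ g.1 i j - (1 : Matrix (Fin 2) (Fin 2) _) i j) :
    g ∈ H := by
  rcases ZMod.isUnit_or_isNilpotent_of_prime_pow hp n (g.1 0 0) with hu | hnil
  · exact mem_of_forall_slUnipotent_mem H _ hH g hg hu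
  rcases Nat.eq_zero_or_pos k with rfl | hk
  · have hE : slUnipotent 1 0 1 ∈ H := by simpa using hH 1 0 1
    have hdet := g.2
    rw [det_fin_two] at hdet
    have hc : IsUnit (g.1 1 0) := by
      have h1 : IsUnit (1 - g.1 0 0 * g.1 1 1) :=
        ((Commute.all _ _).isNilpotent_mul_right hnil).isUnit_one_sub
      have h2 : 1 - g.1 0 0 * g.1 1 1 = g.1 1 0 * (-g.1 0 1) := by linear_combination -hdet
      rw [h2] at h1
      exact isUnit_of_mul_isUnit_left h1
    refine (H.mul_mem_cancel_left hE).1 (mem_of_forall_slUnipotent_mem H _ hH _ (by simp) ?_)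
    have : (slUnipotent 1 0 1 * g).1 0 0 = g.1 0 0 + g.1 1 0 := by
      simp [coe_slUnipotent, Matrix.mul_apply, Fin.sum_univ_two]
    rw [this]
    exact hnil.isUnit_add_right_of_commute hc (Commute.all _ _)
  · refine mem_of_forall_slUnipotent_mem H _ hH g hg ?_
    obtain ⟨α, hα⟩ := hg 0 0
    have : g.1 0 0 = 1 + (p : ZMod (p ^ n)) ^ k * α := by
      rw [← hα, one_apply_eq]; ring
    rw [this]
    exact ((Commute.all _ _).isNilpotent_mul_right
      ((ZMod.isNilpotent_natCast_prime_pow p n).pow_of_pos hk.ne')).isUnit_one_add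

/-- A nontrivial value of a homomorphism between principal congruence
kernels forces `p₁ = p₂` and bounds the exact `p₁`-divisibility of `ξ - 1`. -/
theorem statement17 (p₁ p₂ : ℕ) (hp₁ : p₁.Prime) (hp₂ : p₂.Prime)
    (m₁ n₁ m₂ n₂ : ℕ) (h₁ : m₁ ≤ n₁) (h₂ : 1 ≤ m₂) (h₂' : m₂ ≤ n₂)
    (h : ↥(SLkerPow p₁ m₁ n₁ h₁) →* ↥(SLkerPow p₂ m₂ n₂ h₂'))
    (ξ : ↥(SLkerPow p₁ m₁ n₁ h₁)) (hξ : h ξ ≠ 1) :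
    p₁ = p₂ ∧
      ∀ x : ℕ,
        (∀ i j, ((p₁ : ZMod (p₁ ^ n₁)) ^ x) ∣
          (((ξ : Matrix.SpecialLinearGroup (Fin 2) (ZMod (p₁ ^ n₁))) :
              Matrix (Fin 2) (Fin 2) (ZMod (p₁ ^ n₁))) i j -
            (1 : Matrix (Fin 2) (Fin 2) (ZMod (p₁ ^ n₁))) i j)) →
        ¬ (∀ i j, ((p₁ : ZMod (p₁ ^ n₁)) ^ (x + 1)) ∣
          (((ξ : Matrix.SpecialLinearGroup (Fin 2) (ZMod (p₁ ^ n₁))) :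
              Matrix (Fin 2) (Fin 2) (ZMod (p₁ ^ n₁))) i j -
            (1 : Matrix (Fin 2) (Fin 2) (ZMod (p₁ ^ n₁))) i j)) →
        x ≤ m₁ + n₂ - m₂ := by
  let H : Subgroup (Matrix.SpecialLinearGroup (Fin 2) (ZMod (p₁ ^ n₁))) :=
    h.ker.map (SLkerPow p₁ m₁ n₁ h₁).subtype
  have hξH : ξ.1 ∉ H := by
    rintro ⟨η, hη, hηξ⟩
    rw [Subtype.ext hηξ] at hη
    exact hξ hη
  have hH (x y t : ZMod (p₁ ^ n₁)) :
      slUnipotent x y (((p₂ ^ (n₂ - m₂) : ℕ) : ZMod (p₁ ^ n₁)) * ((p₁ : ZMod (p₁ ^ n₁)) ^ m₁ * t))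
        ∈ H := by
    rw [← slUnipotent_pow]
    refine ⟨⟨_, slUnipotent_mem_SLkerPow hp₁ h₁ x y t⟩ ^ (p₂ ^ (n₂ - m₂)), ?_, rfl⟩
    exact (map_pow h _ _).trans (SLkerPow_pow_eq_one hp₂ h₂ h₂' _)
  have hp : p₁ = p₂ := by
    by_contra hne
    refine hξH (mem_of_forall_slUnipotent_prime_pow_mem hp₁ H (k := m₁) (fun x y t => ?_) _
      ((mem_SLkerPow_iff hp₁ h₁ _).1 ξ.2))
    have hQ : IsUnit ((p₂ ^ (n₂ - m₂) : ℕ) : ZMod (p₁ ^ n₁)) :=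
      (ZMod.isUnit_iff_coprime _ _).2
        (Nat.Coprime.pow _ _ ((Nat.coprime_primes hp₂ hp₁).2 (Ne.symm hne)))
    obtain ⟨w, hw⟩ := hQ.exists_right_inv
    convert hH x y (w * t) using 2
    linear_combination (-(p₁ : ZMod (p₁ ^ n₁)) ^ m₁ * t) * hw
  refine ⟨hp, fun x hx _ => ?_⟩
  subst hp
  by_contra! hlt
  refine hξH (mem_of_forall_slUnipotent_prime_pow_mem hp₁ H (k := m₁ + (n₂ - m₂))
    (fun x y t => ?_) _ (fun i j => (pow_dvd_pow _ (by omega : m₁ + (n₂ - m₂) ≤ x)).trans (hx i j)))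
  convert hH x y t using 2
  push_cast
  ring
end
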